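/- Let 1 < p < ∞, let W be a matrix A_p weight on ℝ^d with reducing operators V_I, fix I_0 ∈ 𝒟, let 𝒥 be the stopping time where 𝒥(I) consists of the maximal dyadic subcubes J of I with ‖V_J V_I^{−1}‖^p > λ₁ or ‖V_J^{−1} V_I‖^{p'} > λ₂, with λ₁, λ₂ chosen as in the decay lemma (λ₁ depending only on n, d, p and λ₂ ≈ ‖W‖_{A_p}^{p'/p}), and define T_j f⃗ := ∑_{I ∈ ℱ^j} ∑_{ε ∈ 𝒮} W^{1/p} V_I^{−1} f⃗_I^ε h_I^ε. Then there exist constants C > 0 and C' > 1, depending only on p, n, d and independent of W and I_0, such that for every f⃗ with finite Haar expansion and all integers k > j ≥ 1, ∫_{∪_{J ∈ 𝒥^{k−1}} J} |T_j f⃗(x)|^p dx ≤ C ‖W‖_{A_p} 2^{−(k−j−1)/(p C' ‖W‖_{A_p} + 1)} ‖Δ_j f⃗‖_{L^p}^p. -/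

import Mathlib

open MeasureTheory ENNReal
open scoped ComplexOrder

noncomputable section

/-! ## Basic linear-algebra notation -/

/-- The operator norm of an `n × n` complex matrix, viewed as an operator on the
Euclidean space `ℂⁿ`. -/
def matNorm {n : ℕ} (M : Matrix (Fin n) (Fin n) ℂ) : ℝ :=
  ‖Matrix.toEuclideanCLM (𝕜 := ℂ) (n := Fin n) M‖

/-- A matrix applied to a vector of `ℂⁿ` (with its Euclidean norm). -/
def mApp {n : ℕ} (M : Matrix (Fin n) (Fin n) ℂ) (v : EuclideanSpace ℂ (Fin n)) :
    EuclideanSpace ℂ (Fin n) :=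
  Matrix.toEuclideanCLM (𝕜 := ℂ) (n := Fin n) M v


/-- Entrywise measurability of a matrix-valued function. -/
def MatMeasurable {d n : ℕ} (W : (Fin d → ℝ) → Matrix (Fin n) (Fin n) ℂ) : Prop :=
  ∀ i j, Measurable fun x => W x i j

/-! ## Dyadic cubes and Haar functions -/

/-- A dyadic cube in `ℝ^d`, with side length `2^k` and lower-left corner `(m i * 2^k)_i`. -/
structure DCube (d : ℕ) where
  k : ℤ
  m : Fin d → ℤ

namespace DCube

variable {d : ℕ}

/-- The (half-open) cube in `ℝ^d` determined by a dyadic cube. -/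
def set (I : DCube d) : Set (Fin d → ℝ) :=
  {x | ∀ i, (I.m i : ℝ) * 2 ^ I.k ≤ x i ∧ x i < ((I.m i : ℝ) + 1) * 2 ^ I.k}

/-- The volume `|I| = (2^k)^d` of a dyadic cube. -/
def vol (I : DCube d) : ℝ := ((2 : ℝ) ^ I.k) ^ d

/-- The lower-left corner of a dyadic cube. -/
def corner (I : DCube d) : Fin d → ℝ := fun i => (I.m i : ℝ) * 2 ^ I.k

/-- The side length of a dyadic cube. -/
def side (I : DCube d) : ℝ := (2 : ℝ) ^ I.k

end DCube

/-- One-dimensional Haar functions on the dyadic interval `[m·2^k, (m+1)·2^k)`: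
`haar1D true` is the non-cancellative `|I|^{-1/2} χ_I`, while `haar1D false` is
`|I|^{-1/2} (χ_{I_ℓ} - χ_{I_r})`. -/
def haar1D (ε : Bool) (k mm : ℤ) (t : ℝ) : ℝ :=
  if ε then
    Set.indicator {s : ℝ | (mm : ℝ) * 2 ^ k ≤ s ∧ s < ((mm : ℝ) + 1) * 2 ^ k}
      (fun _ => ((2 : ℝ) ^ k) ^ (-(1 / 2 : ℝ))) t
  else
    Set.indicator {s : ℝ | (mm : ℝ) * 2 ^ k ≤ s ∧ s < (mm : ℝ) * 2 ^ k + 2 ^ (k - 1)}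
      (fun _ => ((2 : ℝ) ^ k) ^ (-(1 / 2 : ℝ))) t -
    Set.indicator {s : ℝ | (mm : ℝ) * 2 ^ k + 2 ^ (k - 1) ≤ s ∧ s < ((mm : ℝ) + 1) * 2 ^ k}
      (fun _ => ((2 : ℝ) ^ k) ^ (-(1 / 2 : ℝ))) t

/-- The signature set `𝒮 = {0,1}^d \ {(1,…,1)}` indexing the cancellative Haar functions. -/
def Sfin (d : ℕ) : Finset (Fin d → Bool) := Finset.univ.erase (fun _ => true)

/-- The Haar function `h_I^ε = ∏ i, h_{I_i}^{ε_i}` associated to a dyadic cube `I ⊂ ℝ^d`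
and a signature `ε ∈ {0,1}^d`. -/
def haarFn {d : ℕ} (I : DCube d) (ε : Fin d → Bool) (x : Fin d → ℝ) : ℝ :=
  ∏ i, haar1D (ε i) I.k (I.m i) (x i)

/-- The (vector of) Haar coefficients `f_I^ε = ∫ f h_I^ε` of a `ℂⁿ`-valued function. -/
def haarCoef {d n : ℕ} (f : (Fin d → ℝ) → EuclideanSpace ℂ (Fin n)) (I : DCube d)
    (ε : Fin d → Bool) : EuclideanSpace ℂ (Fin n) :=
  ∫ x, haarFn I ε x • f x

/-! ## Matrix `A_p` weights and reducing operators -/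

/-- The (closed, axis-parallel) cube with corner `c` and side length `r`. -/
def cubeSet {d : ℕ} (c : Fin d → ℝ) (r : ℝ) : Set (Fin d → ℝ) :=
  {x | ∀ i, c i ≤ x i ∧ x i ≤ c i + r}

/-- The matrix `A_p` characteristic `‖W‖_{A_p}` of a matrix weight `W`, expressed in terms of
`W1p = W^{1/p}` (so that `W^{-1/p} = (W1p)⁻¹`):
`sup_I (1/|I|) ∫_I ((1/|I|) ∫_I ‖W^{1/p}(x) W^{-1/p}(t)‖^{p'} dt)^{p/p'} dx`,
the supremum being over all cubes `I ⊂ ℝ^d`.  Here `p' = p/(p-1)` and `p/p' = p - 1`. -/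
def apNorm {d n : ℕ} (p : ℝ) (W1p : (Fin d → ℝ) → Matrix (Fin n) (Fin n) ℂ) : ℝ≥0∞ :=
  ⨆ (c : Fin d → ℝ) (r : ℝ) (_ : 0 < r),
    (ENNReal.ofReal (r ^ d))⁻¹ *
      ∫⁻ x in cubeSet c r,
        ((ENNReal.ofReal (r ^ d))⁻¹ *
            ∫⁻ t in cubeSet c r,
              ENNReal.ofReal (matNorm (W1p x * (W1p t)⁻¹)) ^ (p / (p - 1))) ^ (p - 1)

/-- The `L^q` average `(|I|^{-1} ∫_I ‖A(x) e‖^q dx)^{1/q}` over a dyadic cube. -/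
def redAvgD {d n : ℕ} (q : ℝ) (A : (Fin d → ℝ) → Matrix (Fin n) (Fin n) ℂ) (I : DCube d)
    (e : EuclideanSpace ℂ (Fin n)) : ℝ≥0∞ :=
  ((ENNReal.ofReal I.vol)⁻¹ * ∫⁻ x in I.set, ENNReal.ofReal ‖mApp (A x) e‖ ^ q) ^ (1 / q)

/-- `V` is a family of reducing operators for the weight `W = (W1p)^p` (indexed by dyadic
cubes), with comparability constants `c₁, c₂`:  each `V I` is positive definite and
`|V_I e| ≈ (|I|^{-1} ∫_I |W^{1/p}(x) e|^p dx)^{1/p}`. -/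
def IsReducing {d n : ℕ} (p c₁ c₂ : ℝ) (W1p : (Fin d → ℝ) → Matrix (Fin n) (Fin n) ℂ)
    (V : DCube d → Matrix (Fin n) (Fin n) ℂ) : Prop :=
  ∀ I : DCube d, (V I).PosDef ∧ ∀ e : EuclideanSpace ℂ (Fin n),
    ENNReal.ofReal c₁ * redAvgD p W1p I e ≤ ENNReal.ofReal ‖mApp (V I) e‖ ∧
    ENNReal.ofReal ‖mApp (V I) e‖ ≤ ENNReal.ofReal c₂ * redAvgD p W1p I e

/-- `V'` is a family of dual reducing operators for the weight `W = (W1p)^p`: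
`|V_I' e| ≈ (|I|^{-1} ∫_I |W^{-1/p}(x) e|^{p'} dx)^{1/p'}` with `p' = p/(p-1)`. -/
def IsDualReducing {d n : ℕ} (p c₁ c₂ : ℝ) (W1p : (Fin d → ℝ) → Matrix (Fin n) (Fin n) ℂ)
    (V' : DCube d → Matrix (Fin n) (Fin n) ℂ) : Prop :=
  ∀ I : DCube d, (V' I).PosDef ∧ ∀ e : EuclideanSpace ℂ (Fin n),
    ENNReal.ofReal c₁ * redAvgD (p / (p - 1)) (fun x => (W1p x)⁻¹) I e ≤
        ENNReal.ofReal ‖mApp (V' I) e‖ ∧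
    ENNReal.ofReal ‖mApp (V' I) e‖ ≤
        ENNReal.ofReal c₂ * redAvgD (p / (p - 1)) (fun x => (W1p x)⁻¹) I e

/-- The `L^p(W)` norm `(∫ |W^{1/p}(x) f(x)|^p dx)^{1/p}` (as a value in `[0,∞]`). -/
def wNorm {d n : ℕ} (p : ℝ) (W1p : (Fin d → ℝ) → Matrix (Fin n) (Fin n) ℂ)
    (f : (Fin d → ℝ) → EuclideanSpace ℂ (Fin n)) : ℝ≥0∞ :=
  (∫⁻ x, ENNReal.ofReal ‖mApp (W1p x) (f x)‖ ^ p) ^ (1 / p)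

/-- The square-function expression
`∑_{I ∈ 𝒟} ∑_{ε ∈ 𝒮} |A_I f_I^ε|² |I|^{-1} χ_I(x)` for a family of matrices `A_I`. -/
def sqFn {d n : ℕ} (A : DCube d → Matrix (Fin n) (Fin n) ℂ)
    (f : (Fin d → ℝ) → EuclideanSpace ℂ (Fin n)) (x : Fin d → ℝ) : ℝ≥0∞ :=
  ∑' I : DCube d, ∑ ε ∈ Sfin d,
    Set.indicator I.set
      (fun _ => ENNReal.ofReal (‖mApp (A I) (haarCoef f I ε)‖ ^ 2) / ENNReal.ofReal I.vol) x

/-! ## Stopping times -/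

/-- A stopping time assigns to each dyadic cube `I` a collection `𝒥 I` of pairwise disjoint
dyadic subcubes of `I`. -/
def IsStopping {d : ℕ} (𝒥 : DCube d → Set (DCube d)) : Prop :=
  ∀ I : DCube d, (∀ J ∈ 𝒥 I, J.set ⊆ I.set) ∧
    (𝒥 I).Pairwise fun J K => Disjoint J.set K.set

/-- `ℱ(I)`: the dyadic subcubes of `I` not contained in any stopping cube `J ∈ 𝒥(I)`. -/
def Fcol {d : ℕ} (𝒥 : DCube d → Set (DCube d)) (I : DCube d) : Set (DCube d) :=
  {J | J.set ⊆ I.set ∧ ∀ K ∈ 𝒥 I, ¬J.set ⊆ K.set}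

/-- A stopping time is admissible if `I ∈ ℱ(I)` for every `I`. -/
def Admissible {d : ℕ} (𝒥 : DCube d → Set (DCube d)) : Prop :=
  ∀ I : DCube d, I ∈ Fcol 𝒥 I

/-- The iterated stopping collections: `𝒥^0(I) = {I}` and
`𝒥^{j+1}(I) = ⋃_{J ∈ 𝒥^j(I)} 𝒥(J)`. -/
def JIter {d : ℕ} (𝒥 : DCube d → Set (DCube d)) : ℕ → DCube d → Set (DCube d)
  | 0, I => {I}
  | j + 1, I => ⋃ J ∈ JIter 𝒥 j I, 𝒥 J

/-- A stopping time is decaying with constant `c` if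
`∑_{J ∈ 𝒥(I)} |J| ≤ c |I|` for every `I`. -/
def Decaying {d : ℕ} (c : ℝ) (𝒥 : DCube d → Set (DCube d)) : Prop :=
  ∀ I : DCube d,
    ∑' J : 𝒥 I, ENNReal.ofReal (J : DCube d).vol ≤ ENNReal.ofReal c * ENNReal.ofReal I.vol

/-- `ℱ^j = ℱ^j(I₀) = ⋃_{J ∈ 𝒥^{j-1}(I₀)} ℱ(J)` (intended for `j ≥ 1`). -/
def Fj {d : ℕ} (𝒥 : DCube d → Set (DCube d)) (I₀ : DCube d) (j : ℕ) : Set (DCube d) :=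
  ⋃ J ∈ JIter 𝒥 (j - 1) I₀, Fcol 𝒥 J

/-- The Haar projection `Δ_j f = ∑_{I ∈ ℱ^j} ∑_{ε ∈ 𝒮} f_I^ε h_I^ε`. -/
def deltaHaar {d n : ℕ} (𝒥 : DCube d → Set (DCube d)) (I₀ : DCube d) (j : ℕ)
    (f : (Fin d → ℝ) → EuclideanSpace ℂ (Fin n)) (x : Fin d → ℝ) :
    EuclideanSpace ℂ (Fin n) :=
  ∑' I : Fj 𝒥 I₀ j, ∑ ε ∈ Sfin d, haarFn (I : DCube d) ε x • haarCoef f (I : DCube d) ε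

/-! ## Constant Haar multipliers -/

/-- `∑_{I ∈ S} ∑_{ε ∈ 𝒮} V_I^{-1} f_I^ε h_I^ε(x)`. -/
def projInv {d n : ℕ} (V : DCube d → Matrix (Fin n) (Fin n) ℂ) (S : Set (DCube d))
    (f : (Fin d → ℝ) → EuclideanSpace ℂ (Fin n)) (x : Fin d → ℝ) :
    EuclideanSpace ℂ (Fin n) :=
  ∑' I : S, ∑ ε ∈ Sfin d,
    haarFn (I : DCube d) ε x • mApp ((V (I : DCube d))⁻¹) (haarCoef f (I : DCube d) ε)

/-- A function has finite Haar expansion if it is a finite sum of Haar functions. -/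
def FiniteHaar {d n : ℕ} (f : (Fin d → ℝ) → EuclideanSpace ℂ (Fin n)) : Prop :=
  ∃ F : Finset (DCube d × (Fin d → Bool)),
    ∀ x, f x = ∑ q ∈ F, haarFn q.1 q.2 x • haarCoef f q.1 q.2

/-! ## The weighted stopping time -/

/-- The stopping condition `‖V_J V_I^{-1}‖^p > λ₁` or `‖V_J^{-1} V_I‖^{p'} > λ₂`. -/
def stopBad {d n : ℕ} (p l₁ l₂ : ℝ) (V : DCube d → Matrix (Fin n) (Fin n) ℂ)
    (J I : DCube d) : Prop :=
  l₁ < matNorm (V J * (V I)⁻¹) ^ p ∨ l₂ < matNorm ((V J)⁻¹ * V I) ^ (p / (p - 1))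

/-- The stopping time `𝒥(I)` = maximal dyadic subcubes `J ⊆ I` satisfying `stopBad`. -/
def stopST {d n : ℕ} (p l₁ l₂ : ℝ) (V : DCube d → Matrix (Fin n) (Fin n) ℂ)
    (I : DCube d) : Set (DCube d) :=
  {J | J.set ⊆ I.set ∧ stopBad p l₁ l₂ V J I ∧
    ∀ K : DCube d, K.set ⊆ I.set → stopBad p l₁ l₂ V K I → J.set ⊆ K.set → K = J}

/-! ## A Bellman function for differentially subordinate martingales -/

lemma le_tangent_of_deriv2_nonpos {φ φ' φ'' : ℝ → ℝ} (h₁ : ∀ t, HasDerivAt φ (φ' t) t)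
    (h₂ : ∀ t, HasDerivAt φ' (φ'' t) t) (h₃ : ∀ t, φ'' t ≤ 0) : φ 1 ≤ φ 0 + φ' 0 := by
  have hanti : Antitone φ' := by
    apply antitone_of_deriv_nonpos (fun t => (h₂ t).differentiableAt)
    intro t
    rw [(h₂ t).deriv]
    exact h₃ t
  obtain ⟨c, hc, hc'⟩ := exists_hasDerivAt_eq_slope φ φ' (zero_lt_one)
    (fun t _ => (h₁ t).continuousAt.continuousWithinAt) (fun t _ => h₁ t)
  have := hanti hc.1.le
  rw [hc'] at this
  linarith

lemma hasDerivAt_quadratic (a b c t : ℝ) :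
    HasDerivAt (fun t => a + b * t + c * t ^ 2) (b + 2 * c * t) t := by
  have h := (((hasDerivAt_id t).const_mul b).const_add a).add
    (((hasDerivAt_id t).pow 2).const_mul c)
  refine h.congr_deriv ?_
  simp
  ring

lemma hasDerivAt_affine (b c t : ℝ) :
    HasDerivAt (fun t => b + 2 * c * t) (2 * c) t := by
  have h := ((hasDerivAt_id t).const_mul (2 * c)).const_add b
  refine h.congr_deriv ?_
  simp

/-- Derivative of `r ^ q` for a positive quadratic polynomial `r`. -/
lemma hasDerivAt_quadratic_rpow (a b c q t : ℝ) (h : 0 < a + b * t + c * t ^ 2) :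
    HasDerivAt (fun t => (a + b * t + c * t ^ 2) ^ q)
      ((b + 2 * c * t) * (q * (a + b * t + c * t ^ 2) ^ (q - 1))) t := by
  have := (hasDerivAt_quadratic a b c t).rpow_const (p := q) (Or.inl h.ne')
  convert this using 1
  ring

lemma bellman_le_two {q : ℝ} (hq : 1 / 2 < q) (hq1 : q ≤ 1) {s₀ s₁ s₂ r₀ r₁ r₂ : ℝ}
    (hs : ∀ t : ℝ, 0 < s₀ + s₁ * t + s₂ * t ^ 2)
    (hsr : ∀ t : ℝ, s₀ + s₁ * t + s₂ * t ^ 2 ≤ r₀ + r₁ * t + r₂ * t ^ 2)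
    (hs₂ : 0 ≤ s₂) (hr₂ : r₂ ≤ 2 * s₂) (hsd : s₁ ^ 2 ≤ 4 * s₀ * s₂) :
    (r₀ + r₁ + r₂) ^ q - 2 / (2 * q - 1) * (s₀ + s₁ + s₂) ^ q ≤
      r₀ ^ q - 2 / (2 * q - 1) * s₀ ^ q +
        (r₁ * (q * r₀ ^ (q - 1)) - 2 / (2 * q - 1) * (s₁ * (q * s₀ ^ (q - 1)))) := by
  have hr : ∀ t : ℝ, 0 < r₀ + r₁ * t + r₂ * t ^ 2 := fun t => (hs t).trans_le (hsr t)
  have key := le_tangent_of_deriv2_nonpos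
    (fun t => (hasDerivAt_quadratic_rpow r₀ r₁ r₂ q t (hr t)).sub
      ((hasDerivAt_quadratic_rpow s₀ s₁ s₂ q t (hs t)).const_mul (2 / (2 * q - 1))))
    (fun t => (((hasDerivAt_affine r₁ r₂ t).mul
        ((hasDerivAt_quadratic_rpow r₀ r₁ r₂ (q - 1) t (hr t)).const_mul q))).sub
      (((hasDerivAt_affine s₁ s₂ t).mul
        ((hasDerivAt_quadratic_rpow s₀ s₁ s₂ (q - 1) t (hs t)).const_mul q)).const_mul
          (2 / (2 * q - 1)))) ?_
  · simpa using key
  · intro t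
    have hst := hs t
    have hrt := hr t
    have hle := hsr t
    have hsd' : (s₁ + 2 * s₂ * t) ^ 2 ≤ 4 * s₂ * (s₀ + s₁ * t + s₂ * t ^ 2) := by nlinarith
    generalize s₀ + s₁ * t + s₂ * t ^ 2 = s at *
    generalize r₀ + r₁ * t + r₂ * t ^ 2 = r at *
    generalize s₁ + 2 * s₂ * t = s' at *
    generalize r₁ + 2 * r₂ * t = r' at *
    have e1 : r ^ (q - 1 - 1) = r ^ (q - 1) / r := Real.rpow_sub_one hrt.ne' _
    have e2 : s ^ (q - 1 - 1) = s ^ (q - 1) / s := Real.rpow_sub_one hst.ne' _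
    have hR : 0 < r ^ (q - 1) := Real.rpow_pos_of_pos hrt _
    have hS : 0 < s ^ (q - 1) := Real.rpow_pos_of_pos hst _
    have hRS : r ^ (q - 1) ≤ s ^ (q - 1) :=
      Real.rpow_le_rpow_of_nonpos hst hle (by linarith)
    rw [e1, e2]
    generalize r ^ (q - 1) = R at *
    generalize s ^ (q - 1) = S at *
    have h1 : 2 * r₂ * (q * R) + r' * (q * (r' * ((q - 1) * (R / r)))) ≤ 4 * q * s₂ * R := by
      have : r' * (q * (r' * ((q - 1) * (R / r)))) ≤ 0 := by
        have : r' * (q * (r' * ((q - 1) * (R / r)))) = -((1 - q) * q * r' ^ 2 * (R / r)) := by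
          ring
        rw [this, neg_nonpos]
        have : 0 ≤ 1 - q := by linarith
        positivity
      have : r₂ * (q * R) ≤ 2 * s₂ * (q * R) := by gcongr
      linarith
    have h2 : 2 * s₂ * q * (2 * q - 1) * S ≤
        2 * s₂ * (q * S) + s' * (q * (s' * ((q - 1) * (S / s)))) := by
      have : s' * (q * (s' * ((q - 1) * (S / s)))) = -((1 - q) * q * (s' ^ 2 * (S / s))) := by
        ring
      have h3 : s' ^ 2 * (S / s) ≤ 4 * s₂ * S := by
        calc s' ^ 2 * (S / s) ≤ 4 * s₂ * s * (S / s) := by gcongr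
          _ = 4 * s₂ * S := by field_simp
      have h4 : 0 ≤ (1 - q) * q := mul_nonneg (by linarith) (by linarith)
      rw [this]
      nlinarith
    have hq' : 0 < 2 * q - 1 := by linarith
    have h5 : 4 * q * s₂ * R ≤ 2 / (2 * q - 1) *
        (2 * s₂ * (q * S) + s' * (q * (s' * ((q - 1) * (S / s))))) := by
      calc 4 * q * s₂ * R ≤ 4 * q * s₂ * S := by gcongr
        _ = 2 / (2 * q - 1) * (2 * s₂ * q * (2 * q - 1) * S) := by
          rw [div_mul_eq_mul_div, eq_div_iff hq'.ne']
          ring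
        _ ≤ _ := by gcongr
    linarith

lemma bellman_ge_two {b : ℝ} (hb : 0 ≤ b) {s₀ s₁ s₂ r₀ r₁ r₂ : ℝ}
    (hs : ∀ t : ℝ, 0 < s₀ + s₁ * t + s₂ * t ^ 2)
    (hsr : ∀ t : ℝ, s₀ + s₁ * t + s₂ * t ^ 2 ≤ r₀ + r₁ * t + r₂ * t ^ 2)
    (hs₂ : 0 ≤ s₂) (hr₂ : 0 ≤ r₂) (hrs₂ : r₂ ≤ 2 * s₂) (hsd : s₁ ^ 2 ≤ 4 * s₀ * s₂)
    (hrd : r₁ ^ 2 ≤ 4 * r₀ * r₂) {κ C' C₂ : ℝ} (hκ : κ = 32 * b ^ 2 + 4 * b)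
    (hC' : C' = κ * (4 * κ) ^ b) (hC₂ : C₂ = 4 * (b + 1) * (1 + 2 * b)) :
    (r₀ + r₁ + r₂) ^ (b + 1) -
        C₂ * ((s₀ + s₁ + s₂) * (r₀ + r₁ + r₂) ^ b + C' * (s₀ + s₁ + s₂) ^ (b + 1)) ≤
      r₀ ^ (b + 1) - C₂ * (s₀ * r₀ ^ b + C' * s₀ ^ (b + 1)) +
        (r₁ * ((b + 1) * r₀ ^ b) - C₂ * (s₁ * r₀ ^ b + s₀ * (r₁ * (b * r₀ ^ (b - 1))) +
          C' * (s₁ * ((b + 1) * s₀ ^ b)))) := by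
  have hr : ∀ t : ℝ, 0 < r₀ + r₁ * t + r₂ * t ^ 2 := fun t => (hs t).trans_le (hsr t)
  have key := le_tangent_of_deriv2_nonpos
    (fun t => (hasDerivAt_quadratic_rpow r₀ r₁ r₂ (b + 1) t (hr t)).sub
      ((((hasDerivAt_quadratic s₀ s₁ s₂ t).mul
          (hasDerivAt_quadratic_rpow r₀ r₁ r₂ b t (hr t))).add
        ((hasDerivAt_quadratic_rpow s₀ s₁ s₂ (b + 1) t (hs t)).const_mul C')).const_mul C₂))
    (fun t => ((hasDerivAt_affine r₁ r₂ t).mul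
        ((hasDerivAt_quadratic_rpow r₀ r₁ r₂ (b + 1 - 1) t (hr t)).const_mul (b + 1))).sub
      (((((hasDerivAt_affine s₁ s₂ t).mul (hasDerivAt_quadratic_rpow r₀ r₁ r₂ b t (hr t))).add
        ((hasDerivAt_quadratic s₀ s₁ s₂ t).mul ((hasDerivAt_affine r₁ r₂ t).mul
          ((hasDerivAt_quadratic_rpow r₀ r₁ r₂ (b - 1) t (hr t)).const_mul b)))).add
        (((hasDerivAt_affine s₁ s₂ t).mul
          ((hasDerivAt_quadratic_rpow s₀ s₁ s₂ (b + 1 - 1) t (hs t)).const_mul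
            (b + 1))).const_mul C')).const_mul C₂)) ?_
  · simpa using key
  · intro t
    simp only [add_sub_cancel_right, Pi.mul_apply]
    have hst := hs t
    have hrt := hr t
    have hle := hsr t
    have hsd' : (s₁ + 2 * s₂ * t) ^ 2 ≤ 4 * s₂ * (s₀ + s₁ * t + s₂ * t ^ 2) := by nlinarith
    have hrd' : (r₁ + 2 * r₂ * t) ^ 2 ≤ 4 * r₂ * (r₀ + r₁ * t + r₂ * t ^ 2) := by nlinarith
    generalize s₀ + s₁ * t + s₂ * t ^ 2 = s at *
    generalize r₀ + r₁ * t + r₂ * t ^ 2 = r at *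
    generalize s₁ + 2 * s₂ * t = s' at *
    generalize r₁ + 2 * r₂ * t = r' at *
    have e1 : r ^ (b - 1) = r ^ b / r := Real.rpow_sub_one hrt.ne' _
    have e1' : r ^ (b - 1 - 1) = r ^ b / r / r := by
      rw [Real.rpow_sub_one hrt.ne' (b - 1), e1]
    have e2 : s ^ (b - 1) = s ^ b / s := Real.rpow_sub_one hst.ne' _
    have hR : 0 < r ^ b := Real.rpow_pos_of_pos hrt _
    have hS : 0 < s ^ b := Real.rpow_pos_of_pos hst _
    have hκ0 : 0 ≤ κ := by rw [hκ]; positivity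
    have hC'0 : 0 ≤ C' := by rw [hC']; positivity
    have hκR : κ * s * (r ^ b / r) ≤ 1 / 4 * r ^ b + C' * s ^ b := by
      by_cases hcase : κ * s ≤ 1 / 4 * r
      · have : κ * s * (r ^ b / r) ≤ 1 / 4 * r * (r ^ b / r) := by gcongr
        have h2 : 1 / 4 * r * (r ^ b / r) = 1 / 4 * r ^ b := by field_simp
        have h3 : 0 ≤ C' * s ^ b := by positivity
        linarith
      · have h1 : r ≤ 4 * κ * s := by linarith
        have h2 : r ^ b ≤ (4 * κ) ^ b * s ^ b := by
          rw [← Real.mul_rpow (by positivity) hst.le]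
          exact Real.rpow_le_rpow hrt.le h1 hb
        have h3 : κ * s * (r ^ b / r) ≤ κ * r ^ b := by
          have : s / r ≤ 1 := (div_le_one hrt).2 hle
          calc κ * s * (r ^ b / r) = κ * r ^ b * (s / r) := by ring
            _ ≤ κ * r ^ b * 1 := by gcongr
            _ = _ := by ring
        have h4 : κ * r ^ b ≤ C' * s ^ b := by
          rw [hC', mul_assoc]
          gcongr
        linarith
    rw [e1, e1', e2]
    generalize r ^ b = R at *
    generalize s ^ b = S at *
    set ρ := R / r with hρ
    have hρ0 : 0 < ρ := by positivity
    have hρr : R = ρ * r := by rw [hρ]; field_simp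
    have hρ2 : r' ^ 2 * (ρ / r) ≤ 4 * r₂ * ρ := by
      calc r' ^ 2 * (ρ / r) ≤ 4 * r₂ * r * (ρ / r) := by gcongr
        _ = 4 * r₂ * ρ := by field_simp
    have hr2R : 0 ≤ r₂ * R := by positivity
    have h1 : 2 * r₂ * ((b + 1) * R) + r' * ((b + 1) * (r' * (b * ρ))) ≤
        4 * (b + 1) * (1 + 2 * b) * s₂ * R := by
      have h3 : r' ^ 2 * ρ ≤ 4 * r₂ * R := by
        calc r' ^ 2 * ρ ≤ 4 * r₂ * r * ρ := by gcongr
          _ = _ := by rw [hρr]; ring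
      have h4 : r' * ((b + 1) * (r' * (b * ρ))) ≤ (b + 1) * b * (4 * r₂ * R) := by
        calc _ = (b + 1) * b * (r' ^ 2 * ρ) := by ring
          _ ≤ _ := by gcongr
      have h5 : (b + 1) * (1 + 2 * b) * R * r₂ ≤ (b + 1) * (1 + 2 * b) * R * (2 * s₂) := by
        gcongr
      linarith
    have h2 : -(2 * b * (s' * r' * ρ)) ≤ s₂ * ρ * (1 / 2 * r + 64 * b ^ 2 * s) := by
      have h3 : -(2 * b * (s' * r')) ≤ 1 / 16 * r' ^ 2 + 16 * b ^ 2 * s' ^ 2 := by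
        nlinarith [sq_nonneg (1 / 4 * r' + 4 * b * s')]
      have h4 : r' ^ 2 ≤ 8 * s₂ * r := by nlinarith
      have h5 : 16 * b ^ 2 * s' ^ 2 ≤ 16 * b ^ 2 * (4 * s₂ * s) := by gcongr
      calc -(2 * b * (s' * r' * ρ)) = -(2 * b * (s' * r')) * ρ := by ring
        _ ≤ (1 / 16 * (8 * s₂ * r) + 16 * b ^ 2 * (4 * s₂ * s)) * ρ := by gcongr; linarith
        _ = _ := by ring
    have h3 : -(8 * b * s₂ * s * ρ) ≤
        s * (2 * r₂ * (b * ρ) + r' * (b * (r' * ((b - 1) * (ρ / r))))) := by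
      have e : s * (2 * r₂ * (b * ρ) + r' * (b * (r' * ((b - 1) * (ρ / r))))) =
          2 * (s * r₂ * b * ρ) + s * b ^ 2 * (r' ^ 2 * (ρ / r)) -
            s * b * (r' ^ 2 * (ρ / r)) := by ring
      have h4 : 0 ≤ s * r₂ * b * ρ := by positivity
      have h5 : 0 ≤ s * b ^ 2 * (r' ^ 2 * (ρ / r)) := by positivity
      have h6 : s * b * (r' ^ 2 * (ρ / r)) ≤ s * b * (4 * (2 * s₂) * ρ) := by
        refine mul_le_mul_of_nonneg_left (hρ2.trans ?_) (by positivity)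
        gcongr
      rw [e]
      linarith
    have h4 : 2 * s₂ * S * C' ≤
        C' * (2 * s₂ * ((b + 1) * S) + s' * ((b + 1) * (s' * (b * (S / s))))) := by
      have e : C' * (2 * s₂ * ((b + 1) * S) + s' * ((b + 1) * (s' * (b * (S / s))))) =
          2 * s₂ * S * C' + 2 * (C' * s₂ * b * S) +
            C' * ((b + 1) * b * (s' ^ 2 * (S / s))) := by ring
      have h5 : 0 ≤ C' * s₂ * b * S := by positivity
      have h6 : 0 ≤ C' * ((b + 1) * b * (s' ^ 2 * (S / s))) := by positivity
      rw [e]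
      linarith
    have h5 : s₂ * R ≤ 2 * s₂ * R + s' * (r' * (b * ρ)) + (s' * (r' * (b * ρ)) +
        s * (2 * r₂ * (b * ρ) + r' * (b * (r' * ((b - 1) * (ρ / r)))))) +
        C' * (2 * s₂ * ((b + 1) * S) + s' * ((b + 1) * (s' * (b * (S / s))))) := by
      have h6 : 2 * s₂ * (κ * s * ρ) ≤ 2 * s₂ * (1 / 4 * R + C' * S) := by gcongr
      have h7 : s₂ * ρ * r = s₂ * R := by rw [hρr]; ring
      rw [hκ] at h6
      linarith
    have h6 : C₂ * (s₂ * R) ≤ _ := mul_le_mul_of_nonneg_left h5 (by rw [hC₂]; positivity)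
    have h7 : C₂ * (s₂ * R) = 4 * (b + 1) * (1 + 2 * b) * s₂ * R := by rw [hC₂]; ring
    linarith

lemma add_rpow_le_two_rpow_mul {a b q : ℝ} (ha : 0 ≤ a) (hb : 0 ≤ b) (hq : 0 ≤ q) :
    (a + b) ^ q ≤ 2 ^ q * (a ^ q + b ^ q) := by
  have h1 : a + b ≤ 2 * max a b := by
    have := le_max_left a b
    have := le_max_right a b
    linarith
  calc (a + b) ^ q ≤ (2 * max a b) ^ q := Real.rpow_le_rpow (by positivity) h1 hq
    _ = 2 ^ q * (max a b) ^ q := Real.mul_rpow (by norm_num) (le_max_of_le_left ha)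
    _ ≤ _ := by
      have := Real.rpow_nonneg ha q
      have := Real.rpow_nonneg hb q
      gcongr
      rcases max_cases a b with h | h <;> rw [h.1] <;> linarith

lemma norm_sq_rpow_half {E : Type*} [NormedAddCommGroup E] (x : E) (p : ℝ) :
    (‖x‖ ^ 2) ^ (p / 2) = ‖x‖ ^ p := by
  rw [← Real.rpow_natCast, ← Real.rpow_mul (norm_nonneg x)]
  congr 1
  push_cast
  ring

lemma exists_bellman (E : Type*) [NormedAddCommGroup E] [InnerProductSpace ℂ E] {p : ℝ}
    (hp : 1 < p) :
    ∃ C : ℝ, 0 < C ∧ ∀ ε : ℝ, 0 < ε → ∃ U : E → E → ℝ,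
      Continuous (fun z : E × E => U z.1 z.2) ∧ U 0 0 ≤ 0 ∧
      (∀ x y, ‖y‖ ^ p ≤ U x y + C * (ε + ‖x‖ ^ p)) ∧
      ∃ c₁ c₂ : E → E → ℝ, ∀ x y h k, ‖k‖ ≤ ‖h‖ →
        U (x + h) (y + k) ≤
          U x y + c₁ x y * (inner ℂ x h).re + c₂ x y * (inner ℂ y k).re := by
  have hnadd : ∀ x h : E, ‖x + h‖ ^ 2 = ‖x‖ ^ 2 + 2 * (inner ℂ x h).re + ‖h‖ ^ 2 := fun x h =>
    norm_add_sq (𝕜 := ℂ) x h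
  have hcs : ∀ x h : E, |(inner ℂ x h).re| ≤ ‖x‖ * ‖h‖ := fun x h =>
    (Complex.abs_re_le_norm _).trans (norm_inner_le_norm x h)
  have hdisc : ∀ (δ : ℝ) (x h : E), 0 < δ →
      (2 * (inner ℂ x h).re) ^ 2 ≤ 4 * (δ + ‖x‖ ^ 2) * ‖h‖ ^ 2 := by
    intro δ x h hδ
    have h1 := sq_le_sq' (by linarith [neg_abs_le (inner ℂ x h).re, hcs x h])
      ((le_abs_self _).trans (hcs x h))
    nlinarith [sq_nonneg ‖h‖]
  have hdisc2 : ∀ (δ : ℝ) (x h y k : E), 0 < δ →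
      (2 * (inner ℂ x h).re + 2 * (inner ℂ y k).re) ^ 2 ≤
        4 * (δ + ‖x‖ ^ 2 + ‖y‖ ^ 2) * (‖h‖ ^ 2 + ‖k‖ ^ 2) := by
    intro δ x h y k hδ
    have h1 : |(inner ℂ x h).re + (inner ℂ y k).re| ≤ ‖x‖ * ‖h‖ + ‖y‖ * ‖k‖ :=
      (abs_add_le _ _).trans (add_le_add (hcs x h) (hcs y k))
    have h2 := sq_le_sq' (by linarith [neg_abs_le ((inner ℂ x h).re + (inner ℂ y k).re)])
      ((le_abs_self _).trans h1)
    have h3 : 0 ≤ δ * (‖h‖ ^ 2 + ‖k‖ ^ 2) := by positivity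
    nlinarith [sq_nonneg (‖x‖ * ‖k‖ - ‖y‖ * ‖h‖)]
  have hspos : ∀ (δ : ℝ) (x h : E) (t : ℝ), 0 < δ →
      δ + ‖x‖ ^ 2 + 2 * (inner ℂ x h).re * t + ‖h‖ ^ 2 * t ^ 2 = δ + ‖x + (t : ℂ) • h‖ ^ 2 := by
    intro δ x h t hδ
    rw [hnadd, inner_smul_right, norm_smul]
    simp [mul_pow]
    ring
  rcases le_or_gt p 2 with hp2 | hp2
  · have hq : 1 / 2 < p / 2 := by linarith
    have hq1 : p / 2 ≤ 1 := by linarith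
    have hC0 : 2 ≤ 2 / (2 * (p / 2) - 1) := by
      rw [le_div_iff₀ (by linarith)]
      linarith
    refine ⟨2 / (2 * (p / 2) - 1) * 2 ^ (p / 2), by positivity, fun ε hε => ?_⟩
    set C₀ := 2 / (2 * (p / 2) - 1) with hC₀
    set δ := ε ^ (2 / p) with hδ
    have hδ0 : 0 < δ := by positivity
    have hδq : δ ^ (p / 2) = ε := by
      rw [hδ, ← Real.rpow_mul hε.le]
      have : 2 / p * (p / 2) = 1 := by field_simp
      rw [this, Real.rpow_one]
    refine ⟨fun x y => (δ + ‖x‖ ^ 2 + ‖y‖ ^ 2) ^ (p / 2) - C₀ * (δ + ‖x‖ ^ 2) ^ (p / 2),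
      ?_, ?_, ?_, ?_⟩
    · refine Continuous.sub (Continuous.rpow_const (by fun_prop) fun z => Or.inr (by linarith))
        (Continuous.mul continuous_const
          (Continuous.rpow_const (by fun_prop) fun z => Or.inr (by linarith)))
    · simp only [norm_zero]
      norm_num
      rw [hδq]
      nlinarith
    · intro x y
      have h1 : ‖y‖ ^ p ≤ (δ + ‖x‖ ^ 2 + ‖y‖ ^ 2) ^ (p / 2) := by
        rw [← norm_sq_rpow_half]
        exact Real.rpow_le_rpow (by positivity) (by nlinarith [sq_nonneg ‖x‖]) (by linarith)
      have h2 := add_rpow_le_two_rpow_mul hδ0.le (sq_nonneg ‖x‖) (by linarith : 0 ≤ p / 2)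
      rw [hδq, norm_sq_rpow_half] at h2
      have h3 : C₀ * (δ + ‖x‖ ^ 2) ^ (p / 2) ≤ C₀ * (2 ^ (p / 2) * (ε + ‖x‖ ^ p)) := by
        gcongr
      simp only
      linarith
    · refine ⟨fun x y => 2 * (p / 2 * (δ + ‖x‖ ^ 2 + ‖y‖ ^ 2) ^ (p / 2 - 1)) -
          C₀ * (2 * (p / 2 * (δ + ‖x‖ ^ 2) ^ (p / 2 - 1))),
        fun x y => 2 * (p / 2 * (δ + ‖x‖ ^ 2 + ‖y‖ ^ 2) ^ (p / 2 - 1)), fun x y h k hkh => ?_⟩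
      have hkh2 : ‖k‖ ^ 2 ≤ ‖h‖ ^ 2 := by gcongr
      have key := bellman_le_two hq hq1 (s₀ := δ + ‖x‖ ^ 2) (s₁ := 2 * (inner ℂ x h).re)
        (s₂ := ‖h‖ ^ 2) (r₀ := δ + ‖x‖ ^ 2 + ‖y‖ ^ 2)
        (r₁ := 2 * (inner ℂ x h).re + 2 * (inner ℂ y k).re) (r₂ := ‖h‖ ^ 2 + ‖k‖ ^ 2)
        (fun t => by rw [hspos δ x h t hδ0]; positivity)
        (fun t => by
          have h1 := hspos δ y k t hδ0
          have h2 : 0 ≤ ‖y + (t : ℂ) • k‖ ^ 2 := by positivity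
          nlinarith) (by positivity) (by linarith) (hdisc δ x h hδ0)
      have e1 : δ + ‖x + h‖ ^ 2 = δ + ‖x‖ ^ 2 + 2 * (inner ℂ x h).re + ‖h‖ ^ 2 := by
        rw [hnadd]; ring
      have e2 : δ + ‖x + h‖ ^ 2 + ‖y + k‖ ^ 2 = δ + ‖x‖ ^ 2 + ‖y‖ ^ 2 +
          (2 * (inner ℂ x h).re + 2 * (inner ℂ y k).re) + (‖h‖ ^ 2 + ‖k‖ ^ 2) := by
        rw [hnadd, hnadd]; ring
      simp only
      rw [e2, e1]
      rw [← hC₀] at key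
      linarith
  · set b := p / 2 - 1 with hb
    have hb0 : 0 ≤ b := by linarith
    have hbp : b + 1 = p / 2 := by rw [hb]; ring
    set κ := 32 * b ^ 2 + 4 * b with hκ
    set C' := κ * (4 * κ) ^ b with hC'
    set C₂ := 4 * (b + 1) * (1 + 2 * b) with hC₂
    have hκ0 : 0 ≤ κ := by positivity
    have hC'0 : 0 ≤ C' := by positivity
    have hC₂4 : 4 ≤ C₂ := by nlinarith
    refine ⟨2 * (C₂ * (2 * C₂) ^ b + C₂ * C') * 2 ^ (p / 2), by positivity, fun ε hε => ?_⟩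
    set δ := ε ^ (2 / p) with hδ
    have hδ0 : 0 < δ := by positivity
    have hδq : δ ^ (p / 2) = ε := by
      rw [hδ, ← Real.rpow_mul hε.le]
      have : 2 / p * (p / 2) = 1 := by field_simp
      rw [this, Real.rpow_one]
    refine ⟨fun x y => 2 * ((δ + ‖x‖ ^ 2 + ‖y‖ ^ 2) ^ (b + 1) -
      C₂ * ((δ + ‖x‖ ^ 2) * (δ + ‖x‖ ^ 2 + ‖y‖ ^ 2) ^ b + C' * (δ + ‖x‖ ^ 2) ^ (b + 1))),
      ?_, ?_, ?_, ?_⟩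
    · have h1 : Continuous fun z : E × E => (δ + ‖z.1‖ ^ 2 + ‖z.2‖ ^ 2) ^ (b + 1) :=
        Continuous.rpow_const (by fun_prop) fun z => Or.inr (by linarith)
      have h2 : Continuous fun z : E × E => (δ + ‖z.1‖ ^ 2 + ‖z.2‖ ^ 2) ^ b :=
        Continuous.rpow_const (by fun_prop) fun z => Or.inr (by linarith)
      have h3 : Continuous fun z : E × E => (δ + ‖z.1‖ ^ 2) ^ (b + 1) :=
        Continuous.rpow_const (by fun_prop) fun z => Or.inr (by linarith)
      fun_prop
    · simp only [norm_zero]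
      norm_num
      rw [Real.rpow_add_one hδ0.ne']
      have h0 : 0 < δ ^ b * δ := by positivity
      have h1 : 0 ≤ C' * (δ ^ b * δ) := by positivity
      nlinarith
    · intro x y
      have hs0 : 0 < δ + ‖x‖ ^ 2 := by positivity
      have hsr : δ + ‖x‖ ^ 2 ≤ δ + ‖x‖ ^ 2 + ‖y‖ ^ 2 := by nlinarith [sq_nonneg ‖y‖]
      have h1 : ‖y‖ ^ p ≤ (δ + ‖x‖ ^ 2 + ‖y‖ ^ 2) ^ (b + 1) := by
        rw [← norm_sq_rpow_half, hbp]
        exact Real.rpow_le_rpow (by positivity) (by nlinarith [sq_nonneg ‖x‖]) (by linarith)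
      have h2 := add_rpow_le_two_rpow_mul hδ0.le (sq_nonneg ‖x‖) (by linarith : 0 ≤ p / 2)
      rw [hδq, norm_sq_rpow_half, ← hbp] at h2
      simp only
      rw [← hbp]
      generalize δ + ‖x‖ ^ 2 + ‖y‖ ^ 2 = r at *
      generalize δ + ‖x‖ ^ 2 = s at *
      have hr0 : 0 < r := hs0.trans_le hsr
      have h3 : C₂ * (s * r ^ b) ≤ 1 / 2 * r ^ (b + 1) + C₂ * (2 * C₂) ^ b * s ^ (b + 1) := by
        rw [Real.rpow_add_one hr0.ne', Real.rpow_add_one hs0.ne']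
        by_cases hcase : C₂ * s ≤ 1 / 2 * r
        · have h4 : C₂ * s * r ^ b ≤ 1 / 2 * r * r ^ b := by gcongr
          have h5 : 0 ≤ C₂ * (2 * C₂) ^ b * (s ^ b * s) := by positivity
          linarith
        · have h4 : r ≤ 2 * C₂ * s := by linarith
          have h5 : r ^ b ≤ (2 * C₂) ^ b * s ^ b := by
            rw [← Real.mul_rpow (by positivity) hs0.le]
            exact Real.rpow_le_rpow hr0.le h4 hb0
          have h6 : C₂ * s * r ^ b ≤ C₂ * s * ((2 * C₂) ^ b * s ^ b) := by gcongr
          have h7 : 0 ≤ r ^ b * r := by positivity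
          linarith
      have h4 : 2 * (C₂ * (2 * C₂) ^ b + C₂ * C') * s ^ (b + 1) ≤
          2 * (C₂ * (2 * C₂) ^ b + C₂ * C') * (2 ^ (b + 1) * (ε + ‖x‖ ^ p)) := by gcongr
      linarith
    · refine ⟨fun x y => 2 * (2 * ((b + 1) * (δ + ‖x‖ ^ 2 + ‖y‖ ^ 2) ^ b) -
          C₂ * (2 * (δ + ‖x‖ ^ 2 + ‖y‖ ^ 2) ^ b + (δ + ‖x‖ ^ 2) *
            (2 * (b * (δ + ‖x‖ ^ 2 + ‖y‖ ^ 2) ^ (b - 1))) +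
            C' * (2 * ((b + 1) * (δ + ‖x‖ ^ 2) ^ b)))),
        fun x y => 2 * (2 * ((b + 1) * (δ + ‖x‖ ^ 2 + ‖y‖ ^ 2) ^ b) -
          C₂ * ((δ + ‖x‖ ^ 2) * (2 * (b * (δ + ‖x‖ ^ 2 + ‖y‖ ^ 2) ^ (b - 1))))),
        fun x y h k hkh => ?_⟩
      have hkh2 : ‖k‖ ^ 2 ≤ ‖h‖ ^ 2 := by gcongr
      have key := bellman_ge_two hb0 (s₀ := δ + ‖x‖ ^ 2) (s₁ := 2 * (inner ℂ x h).re)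
        (s₂ := ‖h‖ ^ 2) (r₀ := δ + ‖x‖ ^ 2 + ‖y‖ ^ 2)
        (r₁ := 2 * (inner ℂ x h).re + 2 * (inner ℂ y k).re) (r₂ := ‖h‖ ^ 2 + ‖k‖ ^ 2)
        (fun t => by rw [hspos δ x h t hδ0]; positivity)
        (fun t => by
          have h1 := hspos δ y k t hδ0
          have h2 : 0 ≤ ‖y + (t : ℂ) • k‖ ^ 2 := by positivity
          nlinarith) (by positivity) (by positivity) (by linarith) (hdisc δ x h hδ0)
        (hdisc2 δ x h y k hδ0) hκ hC' hC₂
      have e1 : δ + ‖x + h‖ ^ 2 = δ + ‖x‖ ^ 2 + 2 * (inner ℂ x h).re + ‖h‖ ^ 2 := by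
        rw [hnadd]; ring
      have e2 : δ + ‖x + h‖ ^ 2 + ‖y + k‖ ^ 2 = δ + ‖x‖ ^ 2 + ‖y‖ ^ 2 +
          (2 * (inner ℂ x h).re + 2 * (inner ℂ y k).re) + (‖h‖ ^ 2 + ‖k‖ ^ 2) := by
        rw [hnadd, hnadd]; ring
      simp only
      rw [e2, e1]
      linarith

/-! ## Dyadic geometry -/

/-- The dyadic interval `[m·2^k, (m+1)·2^k)`. -/
def dyadicIco (k m : ℤ) : Set ℝ := {t | (m : ℝ) * 2 ^ k ≤ t ∧ t < ((m : ℝ) + 1) * 2 ^ k}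

lemma dyadicIco_subset {k m k' m' : ℤ} (hk : k ≤ k') {t : ℝ} (ht : t ∈ dyadicIco k m)
    (ht' : t ∈ dyadicIco k' m') : dyadicIco k m ⊆ dyadicIco k' m' := by
  obtain ⟨N, rfl⟩ := Int.le.dest hk
  have ha : (0 : ℝ) < 2 ^ k := by positivity
  have e : (2 : ℝ) ^ (k + (N : ℤ)) = 2 ^ N * 2 ^ k := by
    rw [zpow_add₀ (by norm_num), zpow_natCast, mul_comm]
  simp only [dyadicIco, Set.mem_ofPred_eq, e, ← mul_assoc] at ht ht' ⊢
  have h1 : (m' : ℝ) * 2 ^ N < m + 1 := lt_of_mul_lt_mul_right (ht'.1.trans_lt ht.2) ha.le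
  have h2 : (m : ℝ) < (m' + 1) * 2 ^ N := lt_of_mul_lt_mul_right (ht.1.trans_lt ht'.2) ha.le
  have h1' : m' * 2 ^ N ≤ m := by
    have : m' * 2 ^ N < m + 1 := by exact_mod_cast h1
    omega
  have h2' : m + 1 ≤ (m' + 1) * 2 ^ N := by
    have : m < (m' + 1) * 2 ^ N := by exact_mod_cast h2
    omega
  have h1'' : (m' : ℝ) * 2 ^ N ≤ m := by exact_mod_cast h1'
  have h2'' : (m : ℝ) + 1 ≤ (m' + 1) * 2 ^ N := by exact_mod_cast h2'
  rintro s ⟨hs1, hs2⟩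
  exact ⟨(mul_le_mul_of_nonneg_right h1'' ha.le).trans hs1,
    hs2.trans_le (mul_le_mul_of_nonneg_right h2'' ha.le)⟩

lemma dyadicIco_eq_Ico (k m : ℤ) : dyadicIco k m = Set.Ico ((m : ℝ) * 2 ^ k) ((m + 1) * 2 ^ k) :=
  rfl

lemma measurableSet_dyadicIco (k m : ℤ) : MeasurableSet (dyadicIco k m) := measurableSet_Ico

lemma volume_dyadicIco (k m : ℤ) : volume (dyadicIco k m) = ENNReal.ofReal (2 ^ k) := by
  rw [dyadicIco_eq_Ico, Real.volume_Ico]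
  congr 1
  ring

namespace DCube

variable {d : ℕ}

lemma set_eq_pi (I : DCube d) : I.set = Set.univ.pi fun i => dyadicIco I.k (I.m i) := by
  ext x
  simp [DCube.set, dyadicIco]

lemma measurableSet_set (I : DCube d) : MeasurableSet I.set := by
  rw [set_eq_pi]
  exact MeasurableSet.univ_pi fun i => measurableSet_dyadicIco _ _

lemma vol_pos (I : DCube d) : 0 < I.vol := by
  unfold DCube.vol
  positivity

lemma volume_set (I : DCube d) : volume I.set = ENNReal.ofReal I.vol := by
  rw [set_eq_pi, volume_pi_pi]
  simp only [volume_dyadicIco, Finset.prod_const, Finset.card_univ, Fintype.card_fin, DCube.vol]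
  rw [ENNReal.ofReal_pow (by positivity)]

lemma volume_set_ne_zero (I : DCube d) : volume I.set ≠ 0 := by
  rw [volume_set]
  simpa using I.vol_pos

lemma volume_set_ne_top (I : DCube d) : volume I.set ≠ ⊤ := by
  rw [volume_set]
  exact ENNReal.ofReal_ne_top

lemma corner_mem (I : DCube d) : I.corner ∈ I.set := by
  intro i
  refine ⟨le_rfl, ?_⟩
  simp only [corner]
  gcongr
  linarith

lemma subset_of_mem {I J : DCube d} (hk : I.k ≤ J.k) {x : Fin d → ℝ} (hI : x ∈ I.set)
    (hJ : x ∈ J.set) : I.set ⊆ J.set :=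
  fun _ hy i => dyadicIco_subset hk (hI i) (hJ i) (hy i)

lemma k_le_of_subset (hd : 0 < d) {I J : DCube d} (h : I.set ⊆ J.set) : I.k ≤ J.k := by
  have h1 := measure_mono (μ := volume) h
  rw [volume_set, volume_set, ENNReal.ofReal_le_ofReal_iff J.vol_pos.le] at h1
  have h2 : (2 : ℝ) ^ I.k ≤ 2 ^ J.k := by
    by_contra hlt
    rw [not_le] at hlt
    exact absurd h1 (not_le.2 (pow_lt_pow_left₀ hlt (by positivity) hd.ne'))
  exact (zpow_le_zpow_iff_right₀ (by norm_num)).1 h2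

lemma eq_of_mem_of_k_eq {I J : DCube d} (hk : I.k = J.k) {x : Fin d → ℝ} (hI : x ∈ I.set)
    (hJ : x ∈ J.set) : I = J := by
  obtain ⟨k, m⟩ := I
  obtain ⟨k', m'⟩ := J
  simp only at hk
  subst hk
  congr
  funext i
  have ha : (0 : ℝ) < 2 ^ k := by positivity
  have h1 := lt_of_mul_lt_mul_right ((hI i).1.trans_lt (hJ i).2) ha.le
  have h2 := lt_of_mul_lt_mul_right ((hJ i).1.trans_lt (hI i).2) ha.le
  have h1' : m i < m' i + 1 := by exact_mod_cast h1
  have h2' : m' i < m i + 1 := by exact_mod_cast h2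
  omega

lemma k_lt_of_subset_of_ne (hd : 0 < d) {I J : DCube d} (h : I.set ⊆ J.set) (hne : I ≠ J) :
    I.k < J.k :=
  lt_of_le_of_ne (k_le_of_subset hd h) fun hk =>
    hne (eq_of_mem_of_k_eq hk I.corner_mem (h I.corner_mem))

lemma disjoint_of_not_subset {I J : DCube d} (hk : I.k ≤ J.k) (h : ¬I.set ⊆ J.set) :
    Disjoint I.set J.set :=
  Set.disjoint_left.2 fun _ hI hJ => h (subset_of_mem hk hI hJ)

/-- The dyadic parent. -/
def parent (I : DCube d) : DCube d := ⟨I.k + 1, fun i => I.m i / 2⟩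

lemma subset_parent (I : DCube d) : I.set ⊆ I.parent.set := by
  refine subset_of_mem (by simp [parent]) I.corner_mem fun i => ?_
  have ha : (0 : ℝ) < 2 ^ I.k := by positivity
  have h1 : I.m i / 2 * 2 ≤ I.m i := by omega
  have h2 : I.m i + 1 ≤ (I.m i / 2 + 1) * 2 := by omega
  have h1' : ((I.m i / 2 : ℤ) : ℝ) * 2 ≤ I.m i := by exact_mod_cast h1
  have h2' : (I.m i : ℝ) + 1 ≤ ((I.m i / 2 : ℤ) + 1) * 2 := by exact_mod_cast h2
  have e : (2 : ℝ) ^ (I.k + 1) = 2 * 2 ^ I.k := by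
    rw [zpow_add_one₀ (by norm_num), mul_comm]
  simp only [parent, corner, e, ← mul_assoc]
  constructor
  · gcongr
  · gcongr
    linarith

lemma parent_subset (hd : 0 < d) {I J : DCube d} (h : I.set ⊆ J.set) (hne : I ≠ J) :
    I.parent.set ⊆ J.set :=
  subset_of_mem (Int.add_one_le_iff.2 (k_lt_of_subset_of_ne hd h hne))
    (I.subset_parent I.corner_mem) (h I.corner_mem)

lemma vol_parent (I : DCube d) : I.parent.vol = 2 ^ d * I.vol := by
  simp only [vol, parent]
  rw [zpow_add_one₀ (by norm_num), mul_comm, mul_pow]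

instance : Countable (DCube d) :=
  Function.Injective.countable (f := fun I : DCube d => (I.k, I.m)) fun I J h => by
    obtain ⟨k, m⟩ := I
    obtain ⟨k', m'⟩ := J
    simp only [Prod.mk.injEq] at h
    rw [h.1, h.2]

lemma finite_subcubes (hd : 0 < d) (K : DCube d) (N : ℤ) :
    {I : DCube d | N ≤ I.k ∧ I.set ⊆ K.set}.Finite := by
  have h : {I : DCube d | N ≤ I.k ∧ I.set ⊆ K.set} ⊆
      ⋃ k ∈ Set.Icc N K.k, (fun m => DCube.mk k m) ''
        (Set.univ.pi fun i => Set.Icc ⌊(K.m i : ℝ) * 2 ^ K.k / 2 ^ k⌋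
          ⌈((K.m i : ℝ) + 1) * 2 ^ K.k / 2 ^ k⌉) := by
    rintro ⟨k, m⟩ ⟨hN, hsub⟩
    simp only [Set.mem_iUnion]
    refine ⟨k, ⟨hN, k_le_of_subset hd hsub⟩, m, ?_, rfl⟩
    have hc := hsub (corner_mem _)
    intro i _
    have hi := hc i
    have ha : (0 : ℝ) < 2 ^ k := by positivity
    simp only [corner] at hi
    constructor
    · refine Int.floor_le_iff.2 ?_
      rw [div_lt_iff₀ ha]
      nlinarith
    · refine Int.le_ceil_iff.2 ?_
      rw [lt_div_iff₀ ha]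
      nlinarith
  refine Set.Finite.subset (Set.Finite.biUnion (Set.finite_Icc _ _) fun k _ => ?_) h
  exact Set.Finite.image _ (Set.Finite.pi fun i => Set.finite_Icc _ _)

end DCube

/-! ## Haar functions -/

lemma haar1D_true (k m : ℤ) (t : ℝ) :
    haar1D true k m t =
      (dyadicIco k m).indicator (fun _ => ((2 : ℝ) ^ k) ^ (-(1 / 2 : ℝ))) t := rfl

lemma haar1D_false (k m : ℤ) (t : ℝ) :
    haar1D false k m t =
      (dyadicIco (k - 1) (2 * m)).indicator (fun _ => ((2 : ℝ) ^ k) ^ (-(1 / 2 : ℝ))) t -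
      (dyadicIco (k - 1) (2 * m + 1)).indicator (fun _ => ((2 : ℝ) ^ k) ^ (-(1 / 2 : ℝ))) t := by
  have e : (2 : ℝ) ^ k = 2 * 2 ^ (k - 1) := by
    rw [← zpow_one_add₀ (by norm_num)]
    congr 1
    ring
  have h1 : dyadicIco (k - 1) (2 * m) =
      {s : ℝ | (m : ℝ) * 2 ^ k ≤ s ∧ s < (m : ℝ) * 2 ^ k + 2 ^ (k - 1)} := by
    ext s
    simp only [dyadicIco, Set.mem_ofPred_eq, e]
    push_cast
    ring_nf
  have h2 : dyadicIco (k - 1) (2 * m + 1) =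
      {s : ℝ | (m : ℝ) * 2 ^ k + 2 ^ (k - 1) ≤ s ∧ s < ((m : ℝ) + 1) * 2 ^ k} := by
    ext s
    simp only [dyadicIco, Set.mem_ofPred_eq, e]
    push_cast
    ring_nf
  rw [h1, h2]
  rfl

lemma dyadicIco_halves_subset (k m : ℤ) :
    dyadicIco (k - 1) (2 * m) ⊆ dyadicIco k m ∧ dyadicIco (k - 1) (2 * m + 1) ⊆ dyadicIco k m := by
  have e : (2 : ℝ) ^ k = 2 * 2 ^ (k - 1) := by
    rw [← zpow_one_add₀ (by norm_num)]
    congr 1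
    ring
  have ha : (0 : ℝ) < 2 ^ (k - 1) := by positivity
  constructor <;>
  · rintro t ⟨h1, h2⟩
    push_cast at h1 h2
    constructor <;> rw [e] <;> nlinarith

lemma measurable_haar1D (ε : Bool) (k m : ℤ) : Measurable (haar1D ε k m) := by
  cases ε
  · have : haar1D false k m = fun t => _ := funext (haar1D_false k m)
    rw [this]
    exact (measurable_const.indicator (measurableSet_dyadicIco _ _)).sub
      (measurable_const.indicator (measurableSet_dyadicIco _ _))
  · exact measurable_const.indicator (measurableSet_dyadicIco k m)

lemma haar1D_eq_zero (ε : Bool) {k m : ℤ} {t : ℝ} (ht : t ∉ dyadicIco k m) :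
    haar1D ε k m t = 0 := by
  cases ε
  · rw [haar1D_false, Set.indicator_of_notMem fun h => ht ((dyadicIco_halves_subset k m).1 h),
      Set.indicator_of_notMem fun h => ht ((dyadicIco_halves_subset k m).2 h), sub_zero]
  · rw [haar1D_true, Set.indicator_of_notMem ht]

lemma dyadicIco_mem_iff {k m k' m' : ℤ} (hk : k ≤ k') {s t : ℝ} (hs : s ∈ dyadicIco k m)
    (ht : t ∈ dyadicIco k m) : s ∈ dyadicIco k' m' ↔ t ∈ dyadicIco k' m' :=
  ⟨fun h => dyadicIco_subset hk hs h ht, fun h => dyadicIco_subset hk ht h hs⟩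

lemma indicator_const_congr {α : Type*} {S : Set α} {c : ℝ} {s t : α} (h : s ∈ S ↔ t ∈ S) :
    S.indicator (fun _ => c) s = S.indicator (fun _ => c) t := by
  by_cases hs : s ∈ S
  · rw [Set.indicator_of_mem hs, Set.indicator_of_mem (h.1 hs)]
  · rw [Set.indicator_of_notMem hs, Set.indicator_of_notMem fun ht => hs (h.2 ht)]

lemma haar1D_congr (ε : Bool) {k m k' m' : ℤ} (hk : k < k') {s t : ℝ} (hs : s ∈ dyadicIco k m)
    (ht : t ∈ dyadicIco k m) : haar1D ε k' m' s = haar1D ε k' m' t := by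
  cases ε
  · rw [haar1D_false, haar1D_false,
      indicator_const_congr (dyadicIco_mem_iff (Int.le_sub_one_of_lt hk) hs ht),
      indicator_const_congr (dyadicIco_mem_iff (Int.le_sub_one_of_lt hk) hs ht)]
  · exact indicator_const_congr (dyadicIco_mem_iff hk.le hs ht)

lemma abs_haar1D_le (ε : Bool) (k m : ℤ) (t : ℝ) :
    |haar1D ε k m t| ≤ 2 * ((2 : ℝ) ^ k) ^ (-(1 / 2 : ℝ)) := by
  have hc : 0 < ((2 : ℝ) ^ k) ^ (-(1 / 2 : ℝ)) := by positivity
  have hi : ∀ S : Set ℝ, |S.indicator (fun _ => ((2 : ℝ) ^ k) ^ (-(1 / 2 : ℝ))) t| ≤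
      ((2 : ℝ) ^ k) ^ (-(1 / 2 : ℝ)) := by
    intro S
    by_cases h : t ∈ S
    · rw [Set.indicator_of_mem h, abs_of_pos hc]
    · rw [Set.indicator_of_notMem h, abs_zero]
      exact hc.le
  cases ε
  · have h1 := hi (dyadicIco (k - 1) (2 * m))
    have h2 := hi (dyadicIco (k - 1) (2 * m + 1))
    rw [haar1D_false]
    refine (abs_sub _ _).trans ((add_le_add h1 h2).trans_eq ?_)
    ring
  · have h1 := hi (dyadicIco k m)
    rw [haar1D_true]
    linarith

lemma integral_haar1D_false (k m : ℤ) : ∫ t, haar1D false k m t = 0 := by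
  have hint : ∀ m' : ℤ, Integrable ((dyadicIco (k - 1) m').indicator
      (fun _ => ((2 : ℝ) ^ k) ^ (-(1 / 2 : ℝ)))) := fun m' =>
    (integrable_indicator_iff (measurableSet_dyadicIco _ _)).2
      (integrableOn_const (by rw [volume_dyadicIco]; exact ENNReal.ofReal_ne_top))
  simp_rw [haar1D_false]
  rw [integral_sub (hint _) (hint _), integral_indicator (measurableSet_dyadicIco _ _),
    integral_indicator (measurableSet_dyadicIco _ _), setIntegral_const, setIntegral_const,
    measureReal_def, measureReal_def, volume_dyadicIco, volume_dyadicIco, sub_self]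

section Haar

variable {d : ℕ}

lemma measurable_haarFn (I : DCube d) (ε : Fin d → Bool) : Measurable (haarFn I ε) :=
  Finset.measurable_prod _ fun i _ => (measurable_haar1D _ _ _).comp (measurable_pi_apply i)

lemma haarFn_eq_zero {I : DCube d} (ε : Fin d → Bool) {x : Fin d → ℝ} (hx : x ∉ I.set) :
    haarFn I ε x = 0 := by
  obtain ⟨i, hi⟩ := not_forall.1 hx
  exact Finset.prod_eq_zero (Finset.mem_univ i) (haar1D_eq_zero _ hi)

lemma haarFn_congr {I L : DCube d} (ε : Fin d → Bool) (hk : L.k < I.k) {x y : Fin d → ℝ}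
    (hx : x ∈ L.set) (hy : y ∈ L.set) : haarFn I ε x = haarFn I ε y :=
  Finset.prod_congr rfl fun i _ => haar1D_congr _ hk (hx i) (hy i)

lemma abs_haarFn_le (I : DCube d) (ε : Fin d → Bool) (x : Fin d → ℝ) :
    |haarFn I ε x| ≤ (2 * ((2 : ℝ) ^ I.k) ^ (-(1 / 2 : ℝ))) ^ d := by
  rw [haarFn, Finset.abs_prod]
  calc _ ≤ ∏ _i : Fin d, (2 * ((2 : ℝ) ^ I.k) ^ (-(1 / 2 : ℝ))) :=
        Finset.prod_le_prod (fun _ _ => abs_nonneg _) fun i _ => abs_haar1D_le _ _ _ _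
    _ = _ := by simp

lemma integral_haarFn {I : DCube d} {ε : Fin d → Bool} (hε : ε ∈ Sfin d) :
    ∫ x, haarFn I ε x = 0 := by
  have hne : ε ≠ fun _ => true := Finset.ne_of_mem_erase hε
  obtain ⟨i, hi⟩ := Function.ne_iff.1 hne
  simp only [haarFn]
  rw [integral_fintype_prod_volume_eq_prod (fun i t => haar1D (ε i) I.k (I.m i) t)]
  refine Finset.prod_eq_zero (Finset.mem_univ i) ?_
  rw [(Bool.eq_false_iff (b := ε i)).2 hi]
  exact integral_haar1D_false _ _

lemma integrable_haarFn (I : DCube d) (ε : Fin d → Bool) : Integrable (haarFn I ε) := by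
  have h : IntegrableOn (haarFn I ε) I.set := by
    refine Measure.integrableOn_of_bounded (I.volume_set_ne_top)
      (measurable_haarFn I ε).aestronglyMeasurable
      (M := (2 * ((2 : ℝ) ^ I.k) ^ (-(1 / 2 : ℝ))) ^ d) ?_
    exact Filter.Eventually.of_forall fun x => abs_haarFn_le I ε x
  exact (integrableOn_iff_integrable_of_support_subset
    (Function.support_subset_iff'.2 fun x hx => haarFn_eq_zero ε hx)).1 h

end Haar

/-! ## Martingale transforms of finite Haar sums -/

section Transform

variable {d n : ℕ}

/-- The block `∑_{ε ∈ 𝒮} c_ε h_I^ε` of cancellative Haar functions on the cube `I`. -/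
def haarBlock (I : DCube d) (c : (Fin d → Bool) → EuclideanSpace ℂ (Fin n)) (x : Fin d → ℝ) :
    EuclideanSpace ℂ (Fin n) :=
  ∑ ε ∈ Sfin d, haarFn I ε x • c ε

variable (I : DCube d) (c : (Fin d → Bool) → EuclideanSpace ℂ (Fin n))

lemma measurable_haarBlock : Measurable (haarBlock I c) :=
  Finset.measurable_sum _ fun ε _ => (measurable_haarFn I ε).smul_const _

variable {I} in
lemma haarBlock_eq_zero {x : Fin d → ℝ} (hx : x ∉ I.set) : haarBlock I c x = 0 :=
  Finset.sum_eq_zero fun ε _ => by rw [haarFn_eq_zero ε hx, zero_smul]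

variable {I} in
lemma haarBlock_congr {L : DCube d} (hk : L.k < I.k) {x y : Fin d → ℝ}
    (hx : x ∈ L.set) (hy : y ∈ L.set) : haarBlock I c x = haarBlock I c y :=
  Finset.sum_congr rfl fun ε _ => by rw [haarFn_congr ε hk hx hy]

lemma exists_norm_haarBlock_le : ∃ M, ∀ x, ‖haarBlock I c x‖ ≤ M := by
  refine ⟨∑ ε ∈ Sfin d, (2 * ((2 : ℝ) ^ I.k) ^ (-(1 / 2 : ℝ))) ^ d * ‖c ε‖, fun x => ?_⟩
  refine (norm_sum_le _ _).trans (Finset.sum_le_sum fun ε _ => ?_)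
  rw [norm_smul]
  gcongr
  exact abs_haarFn_le I ε x

lemma integrable_haarBlock : Integrable (haarBlock I c) :=
  integrable_finsetSum _ fun ε _ => (integrable_haarFn I ε).smul_const _

lemma integral_haarBlock : ∫ x, haarBlock I c x = 0 := by
  simp only [haarBlock]
  rw [integral_finsetSum _ fun ε _ => (integrable_haarFn I ε).smul_const _]
  refine Finset.sum_eq_zero fun ε hε => ?_
  rw [integral_smul_const, integral_haarFn hε, zero_smul]

variable {I} in
lemma setIntegral_re_inner_haarBlock {K : DCube d} (hIK : I.set ⊆ K.set)
    (v : EuclideanSpace ℂ (Fin n)) :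
    IntegrableOn (fun x => (inner ℂ v (haarBlock I c x)).re) K.set ∧
      ∫ x in K.set, (inner ℂ v (haarBlock I c x)).re = 0 := by
  have hint : Integrable (fun x => inner ℂ v (haarBlock I c x)) :=
    (integrable_haarBlock I c).const_inner v
  refine ⟨hint.re.integrableOn, ?_⟩
  rw [setIntegral_eq_integral_of_forall_compl_eq_zero]
  · have h1 := integral_re hint
    have h2 : ∫ x, inner ℂ v (haarBlock I c x) = 0 := by
      rw [integral_inner (integrable_haarBlock I c), integral_haarBlock, inner_zero_right]
    rw [h2] at h1
    simpa using h1
  · intro x hx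
    rw [haarBlock_eq_zero c fun h => hx (hIK h), inner_zero_right, Complex.zero_re]

lemma measurable_sum_haarBlock (s : Finset (DCube d))
    (c : DCube d → (Fin d → Bool) → EuclideanSpace ℂ (Fin n)) :
    Measurable fun x => ∑ I ∈ s, haarBlock I (c I) x :=
  Finset.measurable_sum _ fun I _ => measurable_haarBlock I (c I)

lemma exists_norm_sum_haarBlock_le (s : Finset (DCube d))
    (c : DCube d → (Fin d → Bool) → EuclideanSpace ℂ (Fin n)) :
    ∃ M, ∀ x, ‖∑ I ∈ s, haarBlock I (c I) x‖ ≤ M := by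
  choose M hM using fun I : DCube d => exists_norm_haarBlock_le I (c I)
  exact ⟨∑ I ∈ s, M I, fun x => (norm_sum_le _ _).trans (Finset.sum_le_sum fun I _ => hM I x)⟩

lemma sum_haarBlock_congr {s : Finset (DCube d)} {L : DCube d} (hL : L ∉ s)
    (hk : ∀ I ∈ s, L.k ≤ I.k) (c : DCube d → (Fin d → Bool) → EuclideanSpace ℂ (Fin n))
    {x y : Fin d → ℝ} (hx : x ∈ L.set) (hy : y ∈ L.set) :
    ∑ I ∈ s, haarBlock I (c I) x = ∑ I ∈ s, haarBlock I (c I) y := by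
  refine Finset.sum_congr rfl fun I hI => ?_
  rcases (hk I hI).lt_or_eq with h | h
  · exact haarBlock_congr _ h hx hy
  · have hne : L ≠ I := fun h => hL (h ▸ hI)
    rw [haarBlock_eq_zero _ fun hxI => hne (DCube.eq_of_mem_of_k_eq h hx hxI),
      haarBlock_eq_zero _ fun hyI => hne (DCube.eq_of_mem_of_k_eq h hy hyI)]

lemma integrableOn_comp_sum_haarBlock {U : EuclideanSpace ℂ (Fin n) → EuclideanSpace ℂ (Fin n) → ℝ}
    (hU : Continuous (fun z : EuclideanSpace ℂ (Fin n) × EuclideanSpace ℂ (Fin n) => U z.1 z.2))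
    (s : Finset (DCube d)) (c c' : DCube d → (Fin d → Bool) → EuclideanSpace ℂ (Fin n))
    (K : DCube d) :
    IntegrableOn (fun x => U (∑ I ∈ s, haarBlock I (c I) x) (∑ I ∈ s, haarBlock I (c' I) x))
      K.set := by
  obtain ⟨M, hM⟩ := exists_norm_sum_haarBlock_le s c
  obtain ⟨M', hM'⟩ := exists_norm_sum_haarBlock_le s c'
  obtain ⟨B, hB⟩ := ((isCompact_closedBall (0 : EuclideanSpace ℂ (Fin n)) M).prod
    (isCompact_closedBall (0 : EuclideanSpace ℂ (Fin n)) M')).exists_bound_of_continuousOn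
      hU.continuousOn
  refine Measure.integrableOn_of_bounded K.volume_set_ne_top
    (hU.measurable.comp ((measurable_sum_haarBlock s c).prodMk
      (measurable_sum_haarBlock s c'))).aestronglyMeasurable (M := B) ?_
  refine Filter.Eventually.of_forall fun x => hB (∑ I ∈ s, haarBlock I (c I) x,
    ∑ I ∈ s, haarBlock I (c' I) x) ⟨mem_closedBall_zero_iff.2 (hM x), mem_closedBall_zero_iff.2 (hM' x)⟩

/-- `L^p` bounds for differentially subordinate transforms of finite Haar sums. -/
lemma exists_transform_bound (d n : ℕ) {p : ℝ} (hp : 1 < p) :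
    ∃ C : ℝ, 0 < C ∧ ∀ (K : DCube d) (s : Finset (DCube d))
      (c c' : DCube d → (Fin d → Bool) → EuclideanSpace ℂ (Fin n)),
      (∀ I ∈ s, I.set ⊆ K.set) →
      (∀ I ∈ s, ∀ x, ‖haarBlock I (c' I) x‖ ≤ ‖haarBlock I (c I) x‖) →
      ∫⁻ x in K.set, ENNReal.ofReal ‖∑ I ∈ s, haarBlock I (c' I) x‖ ^ p ≤
        ENNReal.ofReal C *
          ∫⁻ x in K.set, ENNReal.ofReal ‖∑ I ∈ s, haarBlock I (c I) x‖ ^ p := by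
  obtain ⟨C, hC, hB⟩ := exists_bellman (EuclideanSpace ℂ (Fin n)) hp
  refine ⟨C, hC, fun K s c c' hs hcc' => ?_⟩
  have hpow : Continuous (fun z : EuclideanSpace ℂ (Fin n) × EuclideanSpace ℂ (Fin n) =>
      ‖z.1‖ ^ p) :=
    Continuous.rpow_const (by fun_prop) fun z => Or.inr (by linarith)
  have hf : IntegrableOn (fun x => ‖∑ I ∈ s, haarBlock I (c I) x‖ ^ p) K.set :=
    integrableOn_comp_sum_haarBlock (U := fun x _ => ‖x‖ ^ p) hpow s c c K
  have hg : IntegrableOn (fun x => ‖∑ I ∈ s, haarBlock I (c' I) x‖ ^ p) K.set :=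
    integrableOn_comp_sum_haarBlock (U := fun x _ => ‖x‖ ^ p) hpow s c' c' K
  have hfin : volume K.set ≠ ⊤ := K.volume_set_ne_top
  have hreal : ∀ ε : ℝ, 0 < ε → ∫ x in K.set, ‖∑ I ∈ s, haarBlock I (c' I) x‖ ^ p ≤
      C * (∫ x in K.set, ‖∑ I ∈ s, haarBlock I (c I) x‖ ^ p) + C * volume.real K.set * ε := by
    intro ε hε
    obtain ⟨U, hUc, hU0, hUl, c₁, c₂, hU⟩ := hB ε hε
    have main : ∀ t : Finset (DCube d), (∀ I ∈ t, I ∈ s) →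
        ∫ x in K.set, U (∑ I ∈ t, haarBlock I (c I) x) (∑ I ∈ t, haarBlock I (c' I) x) ≤ 0 := by
      classical
      intro t
      induction t using Finset.induction_on_min_value (fun I : DCube d => I.k) with
      | empty =>
        intro _
        simp only [Finset.sum_empty]
        rw [setIntegral_const]
        exact smul_nonpos_of_nonneg_of_nonpos measureReal_nonneg hU0
      | insert a t hat hmin ih =>
        intro hts
        have hih := ih fun I hI => hts I (Finset.mem_insert_of_mem hI)
        have has : a ∈ s := hts a (Finset.mem_insert_self a t)
        have haK := hs a has
        set X := ∑ I ∈ t, haarBlock I (c I) a.corner with hX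
        set Y := ∑ I ∈ t, haarBlock I (c' I) a.corner with hY
        obtain ⟨hi1, hz1⟩ := setIntegral_re_inner_haarBlock (c a) haK X
        obtain ⟨hi2, hz2⟩ := setIntegral_re_inner_haarBlock (c' a) haK Y
        have hi0 := integrableOn_comp_sum_haarBlock hUc t c c' K
        have hi01 : IntegrableOn (fun x =>
            U (∑ I ∈ t, haarBlock I (c I) x) (∑ I ∈ t, haarBlock I (c' I) x) +
              c₁ X Y * (inner ℂ X (haarBlock a (c a) x)).re) K.set :=
          hi0.add (hi1.const_mul _)
        calc ∫ x in K.set, U (∑ I ∈ insert a t, haarBlock I (c I) x)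
              (∑ I ∈ insert a t, haarBlock I (c' I) x)
            ≤ ∫ x in K.set, (U (∑ I ∈ t, haarBlock I (c I) x) (∑ I ∈ t, haarBlock I (c' I) x) +
              c₁ X Y * (inner ℂ X (haarBlock a (c a) x)).re +
              c₂ X Y * (inner ℂ Y (haarBlock a (c' a) x)).re) := by
              refine setIntegral_mono (integrableOn_comp_sum_haarBlock hUc (insert a t) c c' K)
                (hi01.add (hi2.const_mul _)) fun x => ?_
              simp only
              rw [Finset.sum_insert hat, Finset.sum_insert hat]
              by_cases hx : x ∈ a.set
              · rw [add_comm (haarBlock a (c a) x), add_comm (haarBlock a (c' a) x),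
                  sum_haarBlock_congr hat hmin c hx a.corner_mem,
                  sum_haarBlock_congr hat hmin c' hx a.corner_mem]
                exact hU X Y _ _ (hcc' a has x)
              · rw [haarBlock_eq_zero _ hx, haarBlock_eq_zero _ hx]
                simp
          _ = ∫ x in K.set, U (∑ I ∈ t, haarBlock I (c I) x) (∑ I ∈ t, haarBlock I (c' I) x) := by
              rw [integral_add hi01 (hi2.const_mul _),
                integral_add hi0 (hi1.const_mul _), integral_const_mul, integral_const_mul,
                hz1, hz2]
              ring
          _ ≤ 0 := hih
    have h1 := main s fun _ h => h
    have hiU := integrableOn_comp_sum_haarBlock hUc s c c' K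
    have hiε : IntegrableOn (fun x => C * (ε + ‖∑ I ∈ s, haarBlock I (c I) x‖ ^ p)) K.set :=
      (Integrable.add (integrableOn_const hfin) hf).const_mul C
    have hcst : Integrable (fun _ => ε) (volume.restrict K.set) := integrableOn_const hfin
    calc ∫ x in K.set, ‖∑ I ∈ s, haarBlock I (c' I) x‖ ^ p
        ≤ ∫ x in K.set, (U (∑ I ∈ s, haarBlock I (c I) x) (∑ I ∈ s, haarBlock I (c' I) x) +
            C * (ε + ‖∑ I ∈ s, haarBlock I (c I) x‖ ^ p)) :=
          setIntegral_mono hg (hiU.add hiε) fun x => hUl _ _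
      _ = (∫ x in K.set, U (∑ I ∈ s, haarBlock I (c I) x) (∑ I ∈ s, haarBlock I (c' I) x)) +
            C * (volume.real K.set * ε +
              ∫ x in K.set, ‖∑ I ∈ s, haarBlock I (c I) x‖ ^ p) := by
          rw [integral_add hiU hiε, integral_const_mul, integral_add hcst hf,
            setIntegral_const, smul_eq_mul]
      _ ≤ _ := by linarith
  have hlim : ∫ x in K.set, ‖∑ I ∈ s, haarBlock I (c' I) x‖ ^ p ≤
      C * (∫ x in K.set, ‖∑ I ∈ s, haarBlock I (c I) x‖ ^ p) := by
    have hV : 0 < C * volume.real K.set := by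
      rw [measureReal_def]
      exact mul_pos hC (ENNReal.toReal_pos K.volume_set_ne_zero hfin)
    refine le_of_forall_pos_le_add fun η hη => ?_
    have := hreal (η / (C * volume.real K.set)) (by positivity)
    rwa [mul_div_cancel₀ _ hV.ne'] at this
  have hconv : ∀ c : DCube d → (Fin d → Bool) → EuclideanSpace ℂ (Fin n),
      IntegrableOn (fun x => ‖∑ I ∈ s, haarBlock I (c I) x‖ ^ p) K.set →
      ∫⁻ x in K.set, ENNReal.ofReal ‖∑ I ∈ s, haarBlock I (c I) x‖ ^ p =
        ENNReal.ofReal (∫ x in K.set, ‖∑ I ∈ s, haarBlock I (c I) x‖ ^ p) := by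
    intro c hc
    rw [ofReal_integral_eq_lintegral_ofReal hc
      (Filter.Eventually.of_forall fun x => by positivity)]
    refine lintegral_congr fun x => ?_
    rw [ENNReal.ofReal_rpow_of_nonneg (norm_nonneg _) (by linarith)]
  rw [hconv c hf, hconv c' hg, ← ENNReal.ofReal_mul hC.le]
  exact ENNReal.ofReal_le_ofReal hlim

end Transform

/-! ## Matrices acting on Euclidean space -/

section LinearAlgebra

variable {n : ℕ}

lemma matNorm_nonneg (M : Matrix (Fin n) (Fin n) ℂ) : 0 ≤ matNorm M := norm_nonneg _

lemma norm_mApp_le (M : Matrix (Fin n) (Fin n) ℂ) (v : EuclideanSpace ℂ (Fin n)) :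
    ‖mApp M v‖ ≤ matNorm M * ‖v‖ :=
  ContinuousLinearMap.le_opNorm _ _

lemma mApp_mul (M N : Matrix (Fin n) (Fin n) ℂ) (v : EuclideanSpace ℂ (Fin n)) :
    mApp (M * N) v = mApp M (mApp N v) := by
  simp [mApp, map_mul]

lemma mApp_one (v : EuclideanSpace ℂ (Fin n)) : mApp 1 v = v := by
  simp [mApp]

lemma mApp_smul (M : Matrix (Fin n) (Fin n) ℂ) (c : ℂ) (v : EuclideanSpace ℂ (Fin n)) :
    mApp M (c • v) = c • mApp M v :=
  map_smul _ _ _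

lemma mApp_real_smul (M : Matrix (Fin n) (Fin n) ℂ) (c : ℝ) (v : EuclideanSpace ℂ (Fin n)) :
    mApp M (c • v) = c • mApp M v :=
  ((Matrix.toEuclideanCLM (𝕜 := ℂ) (n := Fin n) M).restrictScalars ℝ).map_smul c v

lemma mApp_sum {ι : Type*} (M : Matrix (Fin n) (Fin n) ℂ) (s : Finset ι)
    (v : ι → EuclideanSpace ℂ (Fin n)) : mApp M (∑ i ∈ s, v i) = ∑ i ∈ s, mApp M (v i) :=
  map_sum _ _ _

lemma mApp_mApp_inv {M : Matrix (Fin n) (Fin n) ℂ} (hM : M.PosDef)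
    (v : EuclideanSpace ℂ (Fin n)) : mApp M (mApp M⁻¹ v) = v := by
  rw [← mApp_mul, Matrix.mul_nonsing_inv _ ((Matrix.isUnit_iff_isUnit_det _).1 hM.isUnit), mApp_one]

lemma mApp_inv_mApp {M : Matrix (Fin n) (Fin n) ℂ} (hM : M.PosDef)
    (v : EuclideanSpace ℂ (Fin n)) : mApp M⁻¹ (mApp M v) = v := by
  rw [← mApp_mul, Matrix.nonsing_inv_mul _ ((Matrix.isUnit_iff_isUnit_det _).1 hM.isUnit), mApp_one]

lemma mApp_eq_zero_iff {M : Matrix (Fin n) (Fin n) ℂ} (hM : M.PosDef)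
    {v : EuclideanSpace ℂ (Fin n)} : mApp M v = 0 ↔ v = 0 := by
  constructor
  · intro h
    rw [← mApp_inv_mApp hM v, h]
    simp [mApp]
  · rintro rfl
    simp [mApp]

lemma matNorm_conjTranspose (M : Matrix (Fin n) (Fin n) ℂ) : matNorm M.conjTranspose = matNorm M := by
  unfold matNorm
  rw [← Matrix.star_eq_conjTranspose, map_star, ContinuousLinearMap.star_eq_adjoint]
  exact LinearIsometryEquiv.norm_map _ _

lemma matNorm_inv_mul {U V : Matrix (Fin n) (Fin n) ℂ} (hU : U.PosDef) (hV : V.PosDef) :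
    matNorm (V⁻¹ * U) = matNorm (U * V⁻¹) := by
  rw [← matNorm_conjTranspose (U * V⁻¹), Matrix.conjTranspose_mul, hU.1.eq,
    hV.inv.1.eq]


/-- Some column of `M` has at least `1/n` of its operator norm. -/
lemma exists_coord_matNorm_le (M : Matrix (Fin n) (Fin n) ℂ) (h : 0 < matNorm M) :
    ∃ i, matNorm M ≤ n * ‖mApp M (EuclideanSpace.single i 1)‖ := by
  by_contra! hlt
  have hn : 0 < n := by
    rcases Nat.eq_zero_or_pos n with rfl | h0
    · exfalso
      refine h.ne' ?_
      unfold matNorm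
      rw [norm_eq_zero]
      exact Subsingleton.elim _ _
    · exact h0
  have hle : matNorm M ≤ ∑ i, ‖mApp M (EuclideanSpace.single i 1)‖ := by
    refine ContinuousLinearMap.opNorm_le_bound _ (Finset.sum_nonneg fun _ _ => norm_nonneg _)
      fun v => ?_
    have hv : v = ∑ i, v i • EuclideanSpace.single i (1 : ℂ) := by
      ext j
      simp [Pi.single_apply]
    change ‖mApp M v‖ ≤ _
    conv_lhs => rw [hv]
    rw [mApp_sum, Finset.sum_mul]
    refine (norm_sum_le _ _).trans (Finset.sum_le_sum fun i _ => ?_)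
    rw [mApp_smul, norm_smul, mul_comm]
    gcongr
    exact PiLp.norm_apply_le v i
  have hlt' : ∑ i, (n : ℝ) * ‖mApp M (EuclideanSpace.single i 1)‖ < ∑ _i : Fin n, matNorm M :=
    Finset.sum_lt_sum_of_nonempty ⟨⟨0, hn⟩, Finset.mem_univ _⟩ fun i _ => hlt i
  rw [← Finset.mul_sum, Finset.sum_const, Finset.card_univ, Fintype.card_fin, nsmul_eq_mul] at hlt'
  have := lt_of_mul_lt_mul_left hlt' (by positivity)
  linarith

end LinearAlgebra

section Measurability

variable {α : Type*} [MeasurableSpace α] {n : ℕ} {A : α → Matrix (Fin n) (Fin n) ℂ}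

lemma measurable_toEuclideanCLM (hA : ∀ i j, Measurable fun x => A x i j) :
    Measurable fun x => Matrix.toEuclideanCLM (𝕜 := ℂ) (n := Fin n) (A x) := by
  have hc : Continuous fun M : Fin n → Fin n → ℂ =>
      Matrix.toEuclideanCLM (𝕜 := ℂ) (n := Fin n) (Matrix.of M) :=
    ((Matrix.toEuclideanCLM (𝕜 := ℂ) (n := Fin n)).toAlgEquiv.toLinearMap ∘ₗ
      (Matrix.ofLinearEquiv ℂ).toLinearMap).continuous_of_finiteDimensional
  exact hc.measurable.comp
    (measurable_pi_lambda _ fun i => measurable_pi_lambda _ fun j => hA i j)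

lemma measurable_mApp (hA : ∀ i j, Measurable fun x => A x i j) (v : EuclideanSpace ℂ (Fin n)) :
    Measurable fun x => mApp (A x) v :=
  (measurable_toEuclideanCLM hA).apply_continuousLinearMap v

lemma measurable_matNorm (hA : ∀ i j, Measurable fun x => A x i j) :
    Measurable fun x => matNorm (A x) :=
  (measurable_toEuclideanCLM hA).norm

lemma measurable_det {m : ℕ} {B : α → Matrix (Fin m) (Fin m) ℂ}
    (hB : ∀ i j, Measurable fun x => B x i j) : Measurable fun x => (B x).det := by
  simp only [Matrix.det_apply]
  exact Finset.measurable_sum _ fun σ _ =>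
    (Finset.measurable_prod _ fun i _ => hB _ _).const_smul _

lemma measurable_matrix_inv_apply (hA : ∀ i j, Measurable fun x => A x i j) (i j : Fin n) :
    Measurable fun x => (A x)⁻¹ i j := by
  simp only [Matrix.inv_def, Matrix.smul_apply, Matrix.adjugate_apply, Ring.inverse_eq_inv', smul_eq_mul]
  refine (measurable_det hA).inv.mul (measurable_det fun k l => ?_)
  simp only [Matrix.updateRow_apply]
  split_ifs
  · exact measurable_const
  · exact hA k l

lemma measurable_matNorm_mul_inv (hA : ∀ i j, Measurable fun x => A x i j)
    (M : Matrix (Fin n) (Fin n) ℂ) : Measurable fun x => matNorm (M * (A x)⁻¹) := by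
  refine measurable_matNorm fun i j => ?_
  simp only [Matrix.mul_apply]
  exact Finset.measurable_sum _ fun k _ => (measurable_matrix_inv_apply hA k j).const_mul _

end Measurability

/-! ## Consequences of the matrix `A_p` condition -/

section Weight

variable {d n : ℕ} {p : ℝ} {W1p : (Fin d → ℝ) → Matrix (Fin n) (Fin n) ℂ}

/-- The mass `∫_S |W^{1/p} v|^p` of the scalar weight `|W^{1/p} v|^p`. -/
def wMass (p : ℝ) (W1p : (Fin d → ℝ) → Matrix (Fin n) (Fin n) ℂ) (v : EuclideanSpace ℂ (Fin n))
    (S : Set (Fin d → ℝ)) : ℝ≥0∞ :=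
  ∫⁻ x in S, ENNReal.ofReal ‖mApp (W1p x) v‖ ^ p

lemma wMass_eq_withDensity (v : EuclideanSpace ℂ (Fin n)) {S : Set (Fin d → ℝ)}
    (hS : MeasurableSet S) :
    wMass p W1p v S =
      (volume.withDensity fun x => ENNReal.ofReal ‖mApp (W1p x) v‖ ^ p) S :=
  (withDensity_apply _ hS).symm

lemma DCube.set_subset_cubeSet (I : DCube d) : I.set ⊆ cubeSet I.corner (2 ^ I.k) := by
  intro x hx i
  refine ⟨(hx i).1, (hx i).2.le.trans_eq ?_⟩
  simp only [DCube.corner]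
  ring

lemma lintegral_matNorm_le_apNorm (hp : 1 < p) (I : DCube d) :
    ∫⁻ x in I.set, (∫⁻ t in I.set,
      ENNReal.ofReal (matNorm (W1p x * (W1p t)⁻¹)) ^ (p / (p - 1))) ^ (p - 1) ≤
      volume I.set ^ p * apNorm p W1p := by
  set R := volume I.set with hR
  have hR0 : R ≠ 0 := I.volume_set_ne_zero
  have hRt : R ≠ ⊤ := I.volume_set_ne_top
  have hRe : ENNReal.ofReal (((2 : ℝ) ^ I.k) ^ d) = R := I.volume_set.symm
  set Q := cubeSet I.corner (2 ^ I.k) with hQ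
  set F : (Fin d → ℝ) → ℝ≥0∞ := fun x => ∫⁻ t in Q,
    ENNReal.ofReal (matNorm (W1p x * (W1p t)⁻¹)) ^ (p / (p - 1)) with hF
  have hA : R⁻¹ * ∫⁻ x in Q, (R⁻¹ * F x) ^ (p - 1) ≤ apNorm p W1p := by
    have h := le_iSup₂_of_le (f := fun (c : Fin d → ℝ) (r : ℝ) => ⨆ (_ : 0 < r),
      (ENNReal.ofReal (r ^ d))⁻¹ *
      ∫⁻ x in cubeSet c r,
        ((ENNReal.ofReal (r ^ d))⁻¹ *
            ∫⁻ t in cubeSet c r,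
              ENNReal.ofReal (matNorm (W1p x * (W1p t)⁻¹)) ^ (p / (p - 1))) ^ (p - 1))
      I.corner ((2 : ℝ) ^ I.k) (le_iSup_of_le (by positivity) le_rfl)
    rwa [hRe] at h
  have hp1 : 0 ≤ p - 1 := by linarith
  calc _ ≤ ∫⁻ x in Q, F x ^ (p - 1) := by
        refine (lintegral_mono fun x => ?_).trans (lintegral_mono_set I.set_subset_cubeSet)
        exact ENNReal.rpow_le_rpow (lintegral_mono_set I.set_subset_cubeSet) hp1
    _ = ∫⁻ x in Q, R ^ (p - 1) * (R⁻¹ * F x) ^ (p - 1) := by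
        refine lintegral_congr fun x => ?_
        rw [← ENNReal.mul_rpow_of_nonneg _ _ hp1, ← mul_assoc, ENNReal.mul_inv_cancel hR0 hRt,
          one_mul]
    _ = R ^ (p - 1) * ∫⁻ x in Q, (R⁻¹ * F x) ^ (p - 1) :=
        lintegral_const_mul' _ _ (ENNReal.rpow_ne_top_of_nonneg hp1 hRt)
    _ = R ^ p * (R⁻¹ * ∫⁻ x in Q, (R⁻¹ * F x) ^ (p - 1)) := by
        rw [← mul_assoc, ENNReal.rpow_sub _ _ hR0 hRt, ENNReal.rpow_one, div_eq_mul_inv]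
    _ ≤ _ := by gcongr

lemma volume_mul_norm_mApp_le (hp : 1 < p) (hW : MatMeasurable W1p)
    (hpos : ∀ᵐ x ∂(volume : Measure (Fin d → ℝ)), (W1p x).PosDef) (x : Fin d → ℝ)
    (v : EuclideanSpace ℂ (Fin n)) (E : Set (Fin d → ℝ)) :
    volume E * ENNReal.ofReal ‖mApp (W1p x) v‖ ≤
      (∫⁻ t in E, ENNReal.ofReal (matNorm (W1p x * (W1p t)⁻¹)) ^ (p / (p - 1))) ^
        (1 / (p / (p - 1))) * wMass p W1p v E ^ (1 / p) := by
  have hpq : (p / (p - 1)).HolderConjugate p := (Real.HolderConjugate.conjExponent hp).symm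
  calc volume E * ENNReal.ofReal ‖mApp (W1p x) v‖
      = ∫⁻ _t in E, ENNReal.ofReal ‖mApp (W1p x) v‖ := by
        rw [setLIntegral_const, mul_comm]
    _ ≤ ∫⁻ t in E, ENNReal.ofReal (matNorm (W1p x * (W1p t)⁻¹)) *
          ENNReal.ofReal ‖mApp (W1p t) v‖ := by
        refine lintegral_mono_ae ((ae_restrict_of_ae hpos).mono fun t ht => ?_)
        rw [← ENNReal.ofReal_mul (matNorm_nonneg _)]
        refine ENNReal.ofReal_le_ofReal ?_
        calc ‖mApp (W1p x) v‖ = ‖mApp (W1p x * (W1p t)⁻¹) (mApp (W1p t) v)‖ := by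
              rw [mApp_mul, mApp_inv_mApp ht]
          _ ≤ _ := norm_mApp_le _ _
    _ ≤ _ := ENNReal.lintegral_mul_le_Lp_mul_Lq _ hpq
        (measurable_matNorm_mul_inv hW _).ennreal_ofReal.aemeasurable
        (measurable_mApp hW v).norm.ennreal_ofReal.aemeasurable

/-- The main consequence of the `A_p` condition: averages of a step function with values `v i`
on disjoint sets `E i` are controlled in `L^p(W)` by the function itself. -/
lemma lintegral_sum_volume_mul_le (hp : 1 < p) (hW : MatMeasurable W1p)
    (hpos : ∀ᵐ x ∂(volume : Measure (Fin d → ℝ)), (W1p x).PosDef) (I : DCube d)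
    {ι : Type*} (s : Finset ι) (E : ι → Set (Fin d → ℝ)) (v : ι → EuclideanSpace ℂ (Fin n))
    (hE : ∀ i ∈ s, MeasurableSet (E i)) (hEI : ∀ i ∈ s, E i ⊆ I.set)
    (hdisj : (s : Set ι).PairwiseDisjoint E) (hfin : ∀ i ∈ s, wMass p W1p (v i) (E i) ≠ ⊤) :
    ∫⁻ x in I.set, (∑ i ∈ s, volume (E i) * ENNReal.ofReal ‖mApp (W1p x) (v i)‖) ^ p ≤
      volume I.set ^ p * apNorm p W1p * ∑ i ∈ s, wMass p W1p (v i) (E i) := by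
  have hp0 : 0 < p := by linarith
  have hp1 : 0 < p - 1 := by linarith
  have hpq : (p / (p - 1)).HolderConjugate p := (Real.HolderConjugate.conjExponent hp).symm
  set q := p / (p - 1) with hq
  have hq0 : 0 < q := by positivity
  set B := ∑ i ∈ s, wMass p W1p (v i) (E i) with hB
  have hBt : B ≠ ⊤ := ENNReal.sum_ne_top.2 hfin
  have hpt : ∀ x, (∑ i ∈ s, volume (E i) * ENNReal.ofReal ‖mApp (W1p x) (v i)‖) ^ p ≤
      (∫⁻ t in I.set, ENNReal.ofReal (matNorm (W1p x * (W1p t)⁻¹)) ^ q) ^ (p - 1) * B := by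
    intro x
    set G : Set (Fin d → ℝ) → ℝ≥0∞ := fun S =>
      ∫⁻ t in S, ENNReal.ofReal (matNorm (W1p x * (W1p t)⁻¹)) ^ q with hG
    have h1 : ∑ i ∈ s, volume (E i) * ENNReal.ofReal ‖mApp (W1p x) (v i)‖ ≤
        G I.set ^ (1 / q) * B ^ (1 / p) := by
      calc _ ≤ ∑ i ∈ s, G (E i) ^ (1 / q) * wMass p W1p (v i) (E i) ^ (1 / p) :=
            Finset.sum_le_sum fun i _ => volume_mul_norm_mApp_le hp hW hpos x (v i) (E i)
        _ ≤ (∑ i ∈ s, (G (E i) ^ (1 / q)) ^ q) ^ (1 / q) *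
              (∑ i ∈ s, (wMass p W1p (v i) (E i) ^ (1 / p)) ^ p) ^ (1 / p) :=
            ENNReal.inner_le_Lp_mul_Lq s _ _ hpq
        _ = (∑ i ∈ s, G (E i)) ^ (1 / q) * B ^ (1 / p) := by
            simp only [← ENNReal.rpow_mul, one_div_mul_cancel hq0.ne',
              one_div_mul_cancel hp0.ne', ENNReal.rpow_one, hB]
        _ ≤ _ := by
            gcongr
            rw [hG]
            simp only
            rw [← lintegral_biUnion_finset hdisj hE]
            exact lintegral_mono_set (Set.iUnion₂_subset hEI)
    calc _ ≤ (G I.set ^ (1 / q) * B ^ (1 / p)) ^ p := ENNReal.rpow_le_rpow h1 hp0.le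
      _ = _ := by
          rw [ENNReal.mul_rpow_of_nonneg _ _ hp0.le, ← ENNReal.rpow_mul, ← ENNReal.rpow_mul,
            one_div_mul_cancel hp0.ne', ENNReal.rpow_one]
          congr 2
          rw [hq]
          field_simp
  calc _ ≤ ∫⁻ x in I.set,
        (∫⁻ t in I.set, ENNReal.ofReal (matNorm (W1p x * (W1p t)⁻¹)) ^ q) ^ (p - 1) * B :=
        lintegral_mono hpt
    _ = (∫⁻ x in I.set,
        (∫⁻ t in I.set, ENNReal.ofReal (matNorm (W1p x * (W1p t)⁻¹)) ^ q) ^ (p - 1)) * B :=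
        lintegral_mul_const' _ _ hBt
    _ ≤ _ := by
        gcongr
        exact lintegral_matNorm_le_apNorm hp I

/-- Doubling of the scalar weights `|W^{1/p} v|^p` on large subsets of a cube. -/
lemma volume_rpow_mul_wMass_le (hp : 1 < p) (hW : MatMeasurable W1p)
    (hpos : ∀ᵐ x ∂(volume : Measure (Fin d → ℝ)), (W1p x).PosDef) (I : DCube d)
    (v : EuclideanSpace ℂ (Fin n)) {E : Set (Fin d → ℝ)} (hE : MeasurableSet E)
    (hEI : E ⊆ I.set) (hfin : wMass p W1p v E ≠ ⊤) :
    volume E ^ p * wMass p W1p v I.set ≤ volume I.set ^ p * apNorm p W1p * wMass p W1p v E := by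
  have hp0 : 0 < p := by linarith
  have h := lintegral_sum_volume_mul_le hp hW hpos I {()} (fun _ => E) (fun _ => v)
    (fun _ _ => hE) (fun _ _ => hEI) (by simp) (fun _ _ => hfin)
  simp only [Finset.sum_singleton, ENNReal.mul_rpow_of_nonneg _ _ hp0.le] at h
  rwa [lintegral_const_mul'] at h
  exact ENNReal.rpow_ne_top_of_nonneg hp0.le
    (measure_ne_top_of_subset hEI I.volume_set_ne_top)

end Weight

/-! ## Reducing operators and decay of the stopping time -/

section Reducing

variable {d n : ℕ} {p c₁ c₂ : ℝ} {W1p : (Fin d → ℝ) → Matrix (Fin n) (Fin n) ℂ}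
  {V : DCube d → Matrix (Fin n) (Fin n) ℂ}

lemma volume_mul_redAvgD_rpow (hp : 0 < p) (I : DCube d) (v : EuclideanSpace ℂ (Fin n)) :
    volume I.set * redAvgD p W1p I v ^ p = wMass p W1p v I.set := by
  rw [redAvgD, ← ENNReal.rpow_mul, one_div_mul_cancel hp.ne', ENNReal.rpow_one, ← I.volume_set,
    ← mul_assoc, ENNReal.mul_inv_cancel I.volume_set_ne_zero I.volume_set_ne_top, one_mul]
  rfl

lemma IsReducing.wMass_le (hV : IsReducing p c₁ c₂ W1p V) (hp : 0 < p) (I : DCube d)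
    (v : EuclideanSpace ℂ (Fin n)) :
    ENNReal.ofReal c₁ ^ p * wMass p W1p v I.set ≤
      volume I.set * ENNReal.ofReal ‖mApp (V I) v‖ ^ p := by
  rw [← volume_mul_redAvgD_rpow hp, mul_left_comm, ← ENNReal.mul_rpow_of_nonneg _ _ hp.le]
  gcongr
  exact ((hV I).2 v).1

lemma IsReducing.le_wMass (hV : IsReducing p c₁ c₂ W1p V) (hp : 0 < p) (I : DCube d)
    (v : EuclideanSpace ℂ (Fin n)) :
    volume I.set * ENNReal.ofReal ‖mApp (V I) v‖ ^ p ≤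
      ENNReal.ofReal c₂ ^ p * wMass p W1p v I.set := by
  rw [← volume_mul_redAvgD_rpow hp, mul_left_comm, ← ENNReal.mul_rpow_of_nonneg _ _ hp.le]
  gcongr
  exact ((hV I).2 v).2

lemma ofReal_rpow_ne_zero {c p : ℝ} (hc : 0 < c) : ENNReal.ofReal c ^ p ≠ 0 :=
  (ENNReal.rpow_pos (ENNReal.ofReal_pos.2 hc) ENNReal.ofReal_ne_top).ne'

lemma ofReal_rpow_ne_top {c p : ℝ} (hp : 0 ≤ p) : ENNReal.ofReal c ^ p ≠ ⊤ :=
  ENNReal.rpow_ne_top_of_nonneg hp ENNReal.ofReal_ne_top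

lemma wMass_mono {v : EuclideanSpace ℂ (Fin n)} {S T : Set (Fin d → ℝ)} (h : S ⊆ T) :
    wMass p W1p v S ≤ wMass p W1p v T :=
  lintegral_mono_set h

lemma IsReducing.wMass_ne_top (hV : IsReducing p c₁ c₂ W1p V) (hp : 0 < p) (hc₁ : 0 < c₁)
    (I : DCube d) (v : EuclideanSpace ℂ (Fin n)) {S : Set (Fin d → ℝ)} (hS : S ⊆ I.set) :
    wMass p W1p v S ≠ ⊤ := by
  refine ne_top_of_le_ne_top (fun h => ?_) (wMass_mono hS)
  have := hV.wMass_le hp I v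
  rw [h, ENNReal.mul_top (ofReal_rpow_ne_zero hc₁), top_le_iff] at this
  exact ENNReal.mul_ne_top I.volume_set_ne_top (ofReal_rpow_ne_top hp.le) this

lemma IsReducing.comparison (hV : IsReducing p c₁ c₂ W1p V) (hp : 0 < p) {J K : DCube d}
    (hJK : J.set ⊆ K.set) (v : EuclideanSpace ℂ (Fin n)) :
    ENNReal.ofReal c₁ ^ p * (volume J.set * ENNReal.ofReal ‖mApp (V J) v‖ ^ p) ≤
      ENNReal.ofReal c₂ ^ p * (volume K.set * ENNReal.ofReal ‖mApp (V K) v‖ ^ p) :=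
  calc _ ≤ ENNReal.ofReal c₁ ^ p * (ENNReal.ofReal c₂ ^ p * wMass p W1p v K.set) := by
        exact mul_le_mul' le_rfl
          ((hV.le_wMass hp J v).trans (mul_le_mul' le_rfl (wMass_mono hJK)))
    _ = ENNReal.ofReal c₂ ^ p * (ENNReal.ofReal c₁ ^ p * wMass p W1p v K.set) := mul_left_comm _ _ _
    _ ≤ _ := by
        exact mul_le_mul' le_rfl (hV.wMass_le hp K v)

lemma IsReducing.one_le_apNorm (hV : IsReducing p c₁ c₂ W1p V) (hp : 1 < p) (hc₁ : 0 < c₁)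
    (hn : 0 < n) (hW : MatMeasurable W1p)
    (hpos : ∀ᵐ x ∂(volume : Measure (Fin d → ℝ)), (W1p x).PosDef) (I : DCube d) :
    1 ≤ apNorm p W1p := by
  have hp0 : 0 < p := by linarith
  set v : EuclideanSpace ℂ (Fin n) := EuclideanSpace.single ⟨0, hn⟩ 1 with hv
  have hv0 : v ≠ 0 := by
    intro h
    have := congrArg norm h
    simp [hv] at this
  have hfin := hV.wMass_ne_top hp0 hc₁ I v subset_rfl
  have h0 : wMass p W1p v I.set ≠ 0 := by
    intro h
    have h1 := hV.le_wMass hp0 I v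
    rw [h, mul_zero, nonpos_iff_eq_zero, mul_eq_zero] at h1
    refine h1.elim I.volume_set_ne_zero (ofReal_rpow_ne_zero (norm_pos_iff.2 fun h2 => hv0 ?_))
    exact (mApp_eq_zero_iff (hV I).1).1 h2
  have h := volume_rpow_mul_wMass_le hp hW hpos I v I.measurableSet_set subset_rfl hfin
  rw [mul_assoc, ENNReal.mul_le_mul_iff_right
    (ENNReal.rpow_pos (pos_iff_ne_zero.2 I.volume_set_ne_zero) I.volume_set_ne_top).ne'
    (ENNReal.rpow_ne_top_of_nonneg hp0.le I.volume_set_ne_top)] at h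
  by_contra! hlt
  exact absurd h (not_le.2 (by simpa using (ENNReal.mul_lt_mul_iff_left h0 hfin).2 hlt))

lemma sum_wMass_le (v : EuclideanSpace ℂ (Fin n)) (s : Finset (DCube d)) (I : DCube d)
    (hs : ∀ J ∈ s, J.set ⊆ I.set) (hdisj : (s : Set (DCube d)).PairwiseDisjoint DCube.set) :
    ∑ J ∈ s, wMass p W1p v J.set ≤ wMass p W1p v I.set := by
  simp only [wMass]
  rw [← lintegral_biUnion_finset hdisj fun J _ => J.measurableSet_set]
  exact lintegral_mono_set (Set.iUnion₂_subset hs)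

/-- Total measure of the disjoint subcubes where `‖V_J V_I⁻¹‖` is large. -/
lemma IsReducing.four_mul_sum_volume_le_of_norm (hV : IsReducing p c₁ c₂ W1p V) (hp : 0 < p)
    {l₁ : ℝ} (hl0 : 0 < l₁) (hc₁ : 0 < c₁)
    (hl₁ : 4 * (n : ℝ≥0∞) * ((n : ℝ≥0∞) ^ p * ENNReal.ofReal c₂ ^ p) ≤
      ENNReal.ofReal c₁ ^ p * ENNReal.ofReal l₁)
    (I : DCube d) (s : Finset (DCube d))
    (hs : ∀ J ∈ s, J.set ⊆ I.set) (hdisj : (s : Set (DCube d)).PairwiseDisjoint DCube.set)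
    (hbad : ∀ J ∈ s, l₁ < matNorm (V J * (V I)⁻¹) ^ p) :
    4 * ∑ J ∈ s, volume J.set ≤ volume I.set := by
  set u : Fin n → EuclideanSpace ℂ (Fin n) :=
    fun i => mApp (V I)⁻¹ (EuclideanSpace.single i 1) with hu
  have hVu : ∀ i, ‖mApp (V I) (u i)‖ = 1 := fun i => by
    rw [hu]
    simp only
    rw [mApp_mApp_inv (hV I).1]
    simp
  have h1 : ∀ J ∈ s, ENNReal.ofReal l₁ * volume J.set ≤
      ((n : ℝ≥0∞) ^ p * ENNReal.ofReal c₂ ^ p) * ∑ i, wMass p W1p (u i) J.set := by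
    intro J hJ
    have hN : 0 < matNorm (V J * (V I)⁻¹) := by
      refine (matNorm_nonneg _).lt_of_ne fun h => ?_
      have := hbad J hJ
      rw [← h, Real.zero_rpow hp.ne'] at this
      linarith
    obtain ⟨i, hi⟩ := exists_coord_matNorm_le _ hN
    rw [mApp_mul] at hi
    have h2 : ENNReal.ofReal l₁ ≤
        (n : ℝ≥0∞) ^ p * ENNReal.ofReal ‖mApp (V J) (u i)‖ ^ p := by
      rw [← ENNReal.mul_rpow_of_nonneg _ _ hp.le, ← ENNReal.ofReal_natCast,
        ← ENNReal.ofReal_mul (by positivity), ENNReal.ofReal_rpow_of_nonneg (by positivity) hp.le]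
      exact ENNReal.ofReal_le_ofReal ((hbad J hJ).le.trans
        (Real.rpow_le_rpow (matNorm_nonneg _) hi hp.le))
    calc _ ≤ (n : ℝ≥0∞) ^ p * ENNReal.ofReal ‖mApp (V J) (u i)‖ ^ p * volume J.set := by gcongr
      _ = (n : ℝ≥0∞) ^ p * (volume J.set * ENNReal.ofReal ‖mApp (V J) (u i)‖ ^ p) := by ring
      _ ≤ (n : ℝ≥0∞) ^ p * (ENNReal.ofReal c₂ ^ p * wMass p W1p (u i) J.set) := by
          exact mul_le_mul' le_rfl (hV.le_wMass hp J (u i))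
      _ ≤ _ := by
          rw [mul_assoc]
          gcongr
          exact Finset.single_le_sum (f := fun i => wMass p W1p (u i) J.set)
            (fun _ _ => zero_le) (Finset.mem_univ i)
  have h3 : ENNReal.ofReal c₁ ^ p * ENNReal.ofReal l₁ * ∑ J ∈ s, volume J.set ≤
      n * ((n : ℝ≥0∞) ^ p * ENNReal.ofReal c₂ ^ p) * volume I.set :=
    calc _ = ENNReal.ofReal c₁ ^ p * ∑ J ∈ s, ENNReal.ofReal l₁ * volume J.set := by
          rw [mul_assoc, Finset.mul_sum]
      _ ≤ ENNReal.ofReal c₁ ^ p * ∑ J ∈ s, ((n : ℝ≥0∞) ^ p * ENNReal.ofReal c₂ ^ p) *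
            ∑ i, wMass p W1p (u i) J.set := by
          exact mul_le_mul' le_rfl (Finset.sum_le_sum h1)
      _ = ((n : ℝ≥0∞) ^ p * ENNReal.ofReal c₂ ^ p) *
            ∑ i, ENNReal.ofReal c₁ ^ p * ∑ J ∈ s, wMass p W1p (u i) J.set := by
          rw [← Finset.mul_sum, Finset.sum_comm, ← Finset.mul_sum]
          ring
      _ ≤ ((n : ℝ≥0∞) ^ p * ENNReal.ofReal c₂ ^ p) * ∑ _i : Fin n, volume I.set := by
          gcongr with i
          calc _ ≤ ENNReal.ofReal c₁ ^ p * wMass p W1p (u i) I.set := by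
                gcongr
                exact sum_wMass_le (u i) s I hs hdisj
            _ ≤ _ := hV.wMass_le hp I (u i)
            _ = _ := by rw [hVu i]; simp
      _ = _ := by
          rw [Finset.sum_const, Finset.card_univ, Fintype.card_fin, nsmul_eq_mul]
          ring
  have hz : ENNReal.ofReal c₁ ^ p * ENNReal.ofReal l₁ ≠ 0 :=
    mul_ne_zero (ofReal_rpow_ne_zero hc₁) (ENNReal.ofReal_pos.2 hl0).ne'
  have ht : ENNReal.ofReal c₁ ^ p * ENNReal.ofReal l₁ ≠ ⊤ :=
    ENNReal.mul_ne_top (ofReal_rpow_ne_top hp.le) ENNReal.ofReal_ne_top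
  rw [← ENNReal.mul_le_mul_iff_right hz ht]
  calc _ = 4 * (ENNReal.ofReal c₁ ^ p * ENNReal.ofReal l₁ * ∑ J ∈ s, volume J.set) := by ring
    _ ≤ 4 * (n * ((n : ℝ≥0∞) ^ p * ENNReal.ofReal c₂ ^ p) * volume I.set) := by gcongr
    _ = (4 * (n : ℝ≥0∞) * ((n : ℝ≥0∞) ^ p * ENNReal.ofReal c₂ ^ p)) * volume I.set := by ring
    _ ≤ _ := by gcongr

lemma exists_phase (z : ℂ) : ∃ θ : ℂ, ‖θ‖ = 1 ∧ θ * z = ‖z‖ := by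
  rcases eq_or_ne z 0 with rfl | hz
  · exact ⟨1, by simp, by simp⟩
  · have hz' : (‖z‖ : ℂ) ≠ 0 := by simpa using hz
    refine ⟨(starRingEnd ℂ) z / ‖z‖, ?_, ?_⟩
    · rw [norm_div, RCLike.norm_conj, Complex.norm_real, norm_norm, div_self (norm_ne_zero_iff.2 hz)]
    · rw [div_mul_eq_mul_div, Complex.conj_mul', sq, mul_div_assoc, div_self hz', mul_one]

/-- Unimodular multiples of unit vectors can be summed with weights `r i` without losing more than
the factor `n`. -/
lemma exists_phases_norm_sum {ι : Type*} (s : Finset ι) (r : ι → ℝ) (hr : ∀ i ∈ s, 0 ≤ r i)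
    (u : ι → EuclideanSpace ℂ (Fin n)) (hu : ∀ i ∈ s, ‖u i‖ = 1) :
    ∃ θ : ι → ℂ, (∀ i, ‖θ i‖ = 1) ∧ ∑ i ∈ s, r i ≤ n * ‖∑ i ∈ s, r i • θ i • u i‖ := by
  choose φ hφ1 hφ2 using exists_phase
  have hl1 : ∀ i ∈ s, 1 ≤ ∑ l, ‖u i l‖ := by
    intro i hi
    rw [← hu i hi]
    have hv : u i = ∑ l, u i l • EuclideanSpace.single l (1 : ℂ) := by
      ext j
      simp [Pi.single_apply]
    conv_lhs => rw [hv]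
    refine (norm_sum_le _ _).trans (Finset.sum_le_sum fun l _ => ?_)
    rw [norm_smul]
    simp
  have hbd : ∀ l : Fin n, ∑ i ∈ s, r i * ‖u i l‖ ≤ ‖∑ i ∈ s, r i • φ (u i l) • u i‖ := by
    intro l
    have h := PiLp.norm_apply_le (∑ i ∈ s, r i • φ (u i l) • u i) l
    have e : (∑ i ∈ s, r i • φ (u i l) • u i) l = ((∑ i ∈ s, r i * ‖u i l‖ : ℝ) : ℂ) := by
      simp [hφ2]
    rw [e, Complex.norm_real, Real.norm_of_nonneg
      (Finset.sum_nonneg fun i hi => mul_nonneg (hr i hi) (norm_nonneg _))] at h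
    exact h
  by_contra! hcon
  have h1 : ∑ i ∈ s, r i ≤ ∑ l, ∑ i ∈ s, r i * ‖u i l‖ := by
    rw [Finset.sum_comm]
    refine Finset.sum_le_sum fun i hi => ?_
    rw [← Finset.mul_sum]
    exact le_mul_of_one_le_right (hr i hi) (hl1 i hi)
  rcases Nat.eq_zero_or_pos n with rfl | hn
  · have := hcon (fun _ => 1) (by simp)
    simp at this h1
    linarith
  · have h2 : ∑ l : Fin n, (n : ℝ) * (∑ i ∈ s, r i * ‖u i l‖) < ∑ _l : Fin n, ∑ i ∈ s, r i := by
      refine Finset.sum_lt_sum_of_nonempty ⟨⟨0, hn⟩, Finset.mem_univ _⟩ fun l _ => ?_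
      exact lt_of_le_of_lt (mul_le_mul_of_nonneg_left (hbd l) (by positivity))
        (hcon (fun i => φ (u i l)) fun i => hφ1 _)
    rw [← Finset.mul_sum, Finset.sum_const, Finset.card_univ, Fintype.card_fin, nsmul_eq_mul] at h2
    have := lt_of_mul_lt_mul_left h2 (by positivity)
    linarith

end Reducing

section Decay

variable {d n : ℕ} {p c₁ c₂ : ℝ} {W1p : (Fin d → ℝ) → Matrix (Fin n) (Fin n) ℂ}
  {V : DCube d → Matrix (Fin n) (Fin n) ℂ}

lemma exists_unit_of_lt_matNorm_inv_mul (hp : 1 < p) {I J : DCube d} (hI : (V I).PosDef)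
    (hJ : (V J).PosDef) {a L : ℝ} (ha : 0 < a) (hL : 0 < L)
    (hbad : L * a ^ (1 / (p - 1)) < matNorm ((V J)⁻¹ * V I) ^ (p / (p - 1))) :
    ∃ u : EuclideanSpace ℂ (Fin n), ‖mApp (V I) u‖ = 1 ∧
      L ^ (p - 1) * a * ‖mApp (V J) u‖ ^ p ≤ (n : ℝ) ^ p := by
  have hp1 : 0 < p - 1 := by linarith
  have hp0 : 0 < p := by linarith
  rw [matNorm_inv_mul hI hJ] at hbad
  have hl : 0 < L * a ^ (1 / (p - 1)) := by positivity
  have hN : 0 < matNorm (V I * (V J)⁻¹) := by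
    refine (matNorm_nonneg _).lt_of_ne fun h => ?_
    rw [← h, Real.zero_rpow (div_pos hp0 hp1).ne'] at hbad
    linarith
  obtain ⟨i, hi⟩ := exists_coord_matNorm_le _ hN
  rw [mApp_mul] at hi
  set e := mApp (V J)⁻¹ (EuclideanSpace.single i (1 : ℂ)) with he
  set g := ‖mApp (V I) e‖ with hg
  have hg0 : 0 < g := by
    refine (norm_nonneg _).lt_of_ne fun h => ?_
    rw [hg, ← h, mul_zero] at hi
    linarith
  refine ⟨g⁻¹ • e, ?_, ?_⟩
  · rw [mApp_real_smul, norm_smul, Real.norm_of_nonneg (by positivity), ← hg,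
      inv_mul_cancel₀ hg0.ne']
  · have hVe : ‖mApp (V J) e‖ = 1 := by
      rw [he, mApp_mApp_inv hJ]
      simp
    rw [mApp_real_smul, norm_smul, hVe, mul_one, Real.norm_of_nonneg (by positivity),
      Real.inv_rpow hg0.le, ← div_eq_mul_inv, div_le_iff₀ (by positivity),
      ← Real.mul_rpow (by positivity) hg0.le]
    calc L ^ (p - 1) * a = (L * a ^ (1 / (p - 1))) ^ (p - 1) := by
          rw [Real.mul_rpow hL.le (by positivity), ← Real.rpow_mul ha.le,
            one_div_mul_cancel hp1.ne', Real.rpow_one]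
      _ ≤ (matNorm (V I * (V J)⁻¹) ^ (p / (p - 1))) ^ (p - 1) :=
          Real.rpow_le_rpow hl.le hbad.le hp1.le
      _ = matNorm (V I * (V J)⁻¹) ^ p := by
          rw [← Real.rpow_mul hN.le, div_mul_cancel₀ _ hp1.ne']
      _ ≤ _ := Real.rpow_le_rpow hN.le hi hp0.le

/-- Total measure of the disjoint subcubes where `‖V_J⁻¹ V_I‖` is large. -/
lemma IsReducing.four_mul_sum_volume_le_of_inv_norm (hV : IsReducing p c₁ c₂ W1p V) (hp : 1 < p)
    {L : ℝ} (hL : 0 < L) (hc₁ : 0 < c₁) (hc₂ : 0 < c₂) (hn : 0 < n)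
    (hL' : ENNReal.ofReal c₂ ^ p * ((n : ℝ≥0∞) ^ p * (n : ℝ≥0∞) ^ p) * 4 ^ (p - 1) ≤
      ENNReal.ofReal c₁ ^ p * ENNReal.ofReal L ^ (p - 1))
    (hW : MatMeasurable W1p)
    (hpos : ∀ᵐ x ∂(volume : Measure (Fin d → ℝ)), (W1p x).PosDef) (hA : apNorm p W1p < ⊤)
    (I : DCube d) (s : Finset (DCube d))
    (hs : ∀ J ∈ s, J.set ⊆ I.set) (hdisj : (s : Set (DCube d)).PairwiseDisjoint DCube.set)
    (hbad : ∀ J ∈ s, L * (apNorm p W1p).toReal ^ (1 / (p - 1)) <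
      matNorm ((V J)⁻¹ * V I) ^ (p / (p - 1))) :
    4 * ∑ J ∈ s, volume J.set ≤ volume I.set := by
  have hp0 : 0 < p := by linarith
  have hp1 : 0 < p - 1 := by linarith
  set A := apNorm p W1p with hAdef
  have hA1 : 1 ≤ A := hV.one_le_apNorm hp hc₁ hn hW hpos I
  have hA0 : A ≠ 0 := (zero_lt_one.trans_le hA1).ne'
  choose! u hu1 hu2 using fun J hJ => exists_unit_of_lt_matNorm_inv_mul hp (hV I).1 (hV J).1
    (ENNReal.toReal_pos hA0 hA.ne) hL (hbad J hJ)
  have hu2' : ∀ J ∈ s, ENNReal.ofReal L ^ (p - 1) * A * ENNReal.ofReal ‖mApp (V J) (u J)‖ ^ p ≤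
      (n : ℝ≥0∞) ^ p := by
    intro J hJ
    have h := ENNReal.ofReal_le_ofReal (hu2 J hJ)
    rwa [ENNReal.ofReal_mul (by positivity), ENNReal.ofReal_mul (by positivity),
      ENNReal.ofReal_toReal hA.ne, ← ENNReal.ofReal_rpow_of_nonneg hL.le hp1.le,
      ← ENNReal.ofReal_rpow_of_nonneg (norm_nonneg _) hp0.le,
      ← ENNReal.ofReal_rpow_of_nonneg (by positivity) hp0.le, ENNReal.ofReal_natCast] at h
  obtain ⟨θ, hθ1, hθ2⟩ := exists_phases_norm_sum s DCube.vol (fun J _ => J.vol_pos.le)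
    (fun J => mApp (V I) (u J)) hu1
  set z := ∑ J ∈ s, J.vol • θ J • u J with hz
  set E := ∑ J ∈ s, volume J.set with hE
  have hEz : E ≤ n * ENNReal.ofReal ‖mApp (V I) z‖ := by
    have e : mApp (V I) z = ∑ J ∈ s, J.vol • θ J • mApp (V I) (u J) := by
      simp only [hz, mApp_sum, mApp_real_smul, mApp_smul]
    rw [← e] at hθ2
    have h := ENNReal.ofReal_le_ofReal hθ2
    rw [ENNReal.ofReal_mul (by positivity), ENNReal.ofReal_natCast,
      ENNReal.ofReal_sum_of_nonneg fun J _ => J.vol_pos.le] at h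
    simpa only [hE, DCube.volume_set] using h
  have hwz : wMass p W1p z I.set ≤ volume I.set ^ p * A * ∑ J ∈ s, wMass p W1p (u J) J.set := by
    refine le_trans (lintegral_mono fun x => ENNReal.rpow_le_rpow ?_ hp0.le)
      (lintegral_sum_volume_mul_le hp hW hpos I s DCube.set u (fun J _ => J.measurableSet_set)
        hs hdisj fun J hJ => hV.wMass_ne_top hp0 hc₁ J (u J) subset_rfl)
    have h : ‖mApp (W1p x) z‖ ≤ ∑ J ∈ s, J.vol * ‖mApp (W1p x) (u J)‖ := by
      simp only [hz, mApp_sum, mApp_real_smul, mApp_smul]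
      refine (norm_sum_le _ _).trans (Finset.sum_le_sum fun J _ => ?_)
      rw [norm_smul, norm_smul, hθ1, one_mul, Real.norm_of_nonneg J.vol_pos.le]
    refine (ENNReal.ofReal_le_ofReal h).trans_eq ?_
    rw [ENNReal.ofReal_sum_of_nonneg fun J _ => mul_nonneg J.vol_pos.le (norm_nonneg _)]
    exact Finset.sum_congr rfl fun J _ => by
      rw [ENNReal.ofReal_mul J.vol_pos.le, DCube.volume_set]
  set R := volume I.set with hR
  have hR0 : R ≠ 0 := I.volume_set_ne_zero
  have hRt : R ≠ ⊤ := I.volume_set_ne_top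
  have hER : E ≤ R := by
    rw [hE, ← measure_biUnion_finset hdisj fun J _ => J.measurableSet_set]
    exact measure_mono (Set.iUnion₂_subset hs)
  have hEt : E ≠ ⊤ := ne_top_of_le_ne_top hRt hER
  rcases eq_or_ne E 0 with hE0 | hE0
  · simp [hE0]
  set α := ENNReal.ofReal c₁ ^ p with hα
  set β := ENNReal.ofReal c₂ ^ p with hβ
  set N := (n : ℝ≥0∞) ^ p with hN
  set Λ := ENNReal.ofReal L ^ (p - 1) with hΛ
  have hβ0 : β ≠ 0 := ofReal_rpow_ne_zero hc₂
  have hβt : β ≠ ⊤ := ofReal_rpow_ne_top hp0.le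
  have hN0 : N ≠ 0 := (ENNReal.rpow_pos (by exact_mod_cast hn) (ENNReal.natCast_ne_top n)).ne'
  have hNt : N ≠ ⊤ := ENNReal.rpow_ne_top_of_nonneg hp0.le (ENNReal.natCast_ne_top n)
  have hsum : α * Λ * A * ∑ J ∈ s, wMass p W1p (u J) J.set ≤ N * E := by
    rw [Finset.mul_sum, hE, Finset.mul_sum]
    refine Finset.sum_le_sum fun J hJ => ?_
    calc _ = Λ * A * (α * wMass p W1p (u J) J.set) := by ring
      _ ≤ Λ * A * (volume J.set * ENNReal.ofReal ‖mApp (V J) (u J)‖ ^ p) :=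
          mul_le_mul' le_rfl (hV.wMass_le hp0 J (u J))
      _ = Λ * A * ENNReal.ofReal ‖mApp (V J) (u J)‖ ^ p * volume J.set := by ring
      _ ≤ _ := mul_le_mul' (hu2' J hJ) le_rfl
  have hchain : (β * (N * N)) * (R ^ p * A * E) * (4 * E) ^ (p - 1) ≤
      (β * (N * N)) * (R ^ p * A * E) * R ^ (p - 1) :=
    calc _ = (β * (N * N) * 4 ^ (p - 1)) * (E ^ p * R) * (R ^ (p - 1) * A) := by
          rw [ENNReal.mul_rpow_of_nonneg _ _ hp1.le, ENNReal.rpow_sub p 1 hE0 hEt,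
            ENNReal.rpow_sub p 1 hR0 hRt, ENNReal.rpow_one, ENNReal.rpow_one]
          have e1 : E * (E ^ p / E) = E ^ p := ENNReal.mul_div_cancel hE0 hEt
          have e2 : R * (R ^ p / R) = R ^ p := ENNReal.mul_div_cancel hR0 hRt
          calc _ = β * (N * N) * 4 ^ (p - 1) * (E * (E ^ p / E)) * R ^ p * A := by ring
            _ = β * (N * N) * 4 ^ (p - 1) * E ^ p * (R * (R ^ p / R)) * A := by rw [e1, e2]
            _ = _ := by ring
      _ ≤ (α * Λ) * (N * (β * wMass p W1p z I.set)) * (R ^ (p - 1) * A) := by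
          refine mul_le_mul' (mul_le_mul' hL' ?_) le_rfl
          calc E ^ p * R ≤ (n * ENNReal.ofReal ‖mApp (V I) z‖) ^ p * R := by gcongr
            _ = N * (R * ENNReal.ofReal ‖mApp (V I) z‖ ^ p) := by
                rw [ENNReal.mul_rpow_of_nonneg _ _ hp0.le]
                ring
            _ ≤ _ := mul_le_mul' le_rfl (hV.le_wMass hp0 I z)
      _ ≤ (α * Λ) * (N * (β * (R ^ p * A * ∑ J ∈ s, wMass p W1p (u J) J.set))) *
            (R ^ (p - 1) * A) := by gcongr
      _ = (β * N) * (R ^ p * A) * R ^ (p - 1) *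
            (α * Λ * A * ∑ J ∈ s, wMass p W1p (u J) J.set) := by ring
      _ ≤ (β * N) * (R ^ p * A) * R ^ (p - 1) * (N * E) := by gcongr
      _ = _ := by ring
  have hRp0 : R ^ p ≠ 0 := (ENNReal.rpow_pos (pos_iff_ne_zero.2 hR0) hRt).ne'
  have hRpt : R ^ p ≠ ⊤ := ENNReal.rpow_ne_top_of_nonneg hp0.le hRt
  have hc0 : β * (N * N) * (R ^ p * A * E) ≠ 0 := by simp [hβ0, hN0, hRp0, hA0, hE0]
  have hct : β * (N * N) * (R ^ p * A * E) ≠ ⊤ :=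
    ENNReal.mul_ne_top (ENNReal.mul_ne_top hβt (ENNReal.mul_ne_top hNt hNt))
      (ENNReal.mul_ne_top (ENNReal.mul_ne_top hRpt hA.ne) hEt)
  exact (ENNReal.rpow_le_rpow_iff hp1).1 ((ENNReal.mul_le_mul_iff_right hc0 hct).1 hchain)

end Decay

/-! ## Iterated stopping times -/

section Stopping

variable {d : ℕ} {𝒥 : DCube d → Set (DCube d)}

lemma mem_JIter_add {a b : ℕ} {I J : DCube d} :
    J ∈ JIter 𝒥 (a + b) I ↔ ∃ K ∈ JIter 𝒥 a I, J ∈ JIter 𝒥 b K := by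
  induction b generalizing J with
  | zero => simp [JIter]
  | succ b ih =>
    rw [← add_assoc]
    simp only [JIter, Set.mem_iUnion, exists_prop, ih]
    constructor
    · rintro ⟨L, ⟨K, hK, hL⟩, hJ⟩
      exact ⟨K, hK, L, hL, hJ⟩
    · rintro ⟨K, hK, L, hL, hJ⟩
      exact ⟨L, ⟨K, hK, hL⟩, hJ⟩

lemma mem_JIter_one_add {m : ℕ} {I J : DCube d} :
    J ∈ JIter 𝒥 (1 + m) I ↔ ∃ K ∈ 𝒥 I, J ∈ JIter 𝒥 m K := by
  rw [mem_JIter_add]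
  simp [JIter]

lemma IsStopping.JIter_subset (h : IsStopping 𝒥) {m : ℕ} {I J : DCube d}
    (hJ : J ∈ JIter 𝒥 m I) : J.set ⊆ I.set := by
  induction m generalizing J with
  | zero => rw [Set.mem_singleton_iff.1 hJ]
  | succ m ih =>
    simp only [JIter, Set.mem_iUnion, exists_prop] at hJ
    obtain ⟨K, hK, hJ⟩ := hJ
    exact ((h K).1 J hJ).trans (ih hK)

lemma IsStopping.pairwiseDisjoint_JIter (h : IsStopping 𝒥) (m : ℕ) (I : DCube d) :
    (JIter 𝒥 m I).PairwiseDisjoint DCube.set := by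
  induction m with
  | zero => exact Set.pairwiseDisjoint_singleton _ _
  | succ m ih =>
    intro J hJ J' hJ' hne
    simp only [JIter, Set.mem_iUnion, exists_prop] at hJ hJ'
    obtain ⟨K, hK, hJ⟩ := hJ
    obtain ⟨K', hK', hJ'⟩ := hJ'
    rcases eq_or_ne K K' with rfl | hKK
    · exact (h K).2 hJ hJ' hne
    · exact (ih hK hK' hKK).mono ((h K).1 J hJ) ((h K').1 J' hJ')

lemma measurableSet_biUnion_cubes (S : Set (DCube d)) : MeasurableSet (⋃ J ∈ S, J.set) :=
  MeasurableSet.biUnion S.to_countable fun J _ => J.measurableSet_set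

lemma IsStopping.measure_JIter_le (h : IsStopping 𝒥) (μ : Measure (Fin d → ℝ)) {θ : ℝ≥0∞}
    (hθ : ∀ I, μ (⋃ J ∈ 𝒥 I, J.set) ≤ θ * μ I.set) (m : ℕ) (I : DCube d) :
    μ (⋃ J ∈ JIter 𝒥 m I, J.set) ≤ θ ^ m * μ I.set := by
  induction m with
  | zero => simp [JIter]
  | succ m ih =>
    calc μ (⋃ J ∈ JIter 𝒥 (m + 1) I, J.set)
        = μ (⋃ K ∈ JIter 𝒥 m I, ⋃ J ∈ 𝒥 K, J.set) := by
          simp only [JIter, Set.biUnion_iUnion]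
      _ ≤ ∑' K : JIter 𝒥 m I, μ (⋃ J ∈ 𝒥 K, J.set) :=
          measure_biUnion_le μ (Set.to_countable _) _
      _ ≤ ∑' K : JIter 𝒥 m I, θ * μ (K : DCube d).set := ENNReal.tsum_le_tsum fun K => hθ K
      _ = θ * μ (⋃ K ∈ JIter 𝒥 m I, K.set) := by
          rw [ENNReal.tsum_mul_left, measure_biUnion (Set.to_countable _)
            (h.pairwiseDisjoint_JIter m I) fun K _ => K.measurableSet_set]
      _ ≤ θ * (θ ^ m * μ I.set) := by gcongr
      _ = θ ^ (m + 1) * μ I.set := by ring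

variable {n : ℕ} {p l₁ l₂ : ℝ} {V : DCube d → Matrix (Fin n) (Fin n) ℂ}

lemma isStopping_stopST : IsStopping (stopST p l₁ l₂ V) := by
  refine fun I => ⟨fun J hJ => hJ.1, fun J hJ K hK hne => ?_⟩
  rcases le_total J.k K.k with h | h
  · exact DCube.disjoint_of_not_subset h fun hs => hne (hJ.2.2 K hK.1 hK.2.1 hs).symm
  · exact (DCube.disjoint_of_not_subset h fun hs => hne (hK.2.2 J hJ.1 hJ.2.1 hs)).symm

lemma exists_mem_stopST (hd : 0 < d) {I L : DCube d} (hL : L.set ⊆ I.set)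
    (hbad : stopBad p l₁ l₂ V L I) : ∃ J ∈ stopST p l₁ l₂ V I, L.set ⊆ J.set := by
  obtain ⟨k, ⟨J, rfl, hJI, hJ, hLJ⟩, hmax⟩ := Int.exists_greatest_of_bdd
    (P := fun k => ∃ J : DCube d, J.k = k ∧ J.set ⊆ I.set ∧ stopBad p l₁ l₂ V J I ∧
      L.set ⊆ J.set)
    ⟨I.k, by rintro _ ⟨J, rfl, hJ, -, -⟩; exact DCube.k_le_of_subset hd hJ⟩
    ⟨L.k, L, rfl, hL, hbad, subset_rfl⟩
  refine ⟨J, ⟨hJI, hJ, fun K hKI hK hJK => ?_⟩, hLJ⟩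
  exact DCube.eq_of_mem_of_k_eq
    (le_antisymm (hmax _ ⟨K, rfl, hKI, hK, hLJ.trans hJK⟩) (DCube.k_le_of_subset hd hJK))
    (hJK J.corner_mem) J.corner_mem

lemma not_stopBad_of_mem_Fcol (hd : 0 < d) {I L : DCube d}
    (hL : L ∈ Fcol (stopST p l₁ l₂ V) I) : ¬stopBad p l₁ l₂ V L I := fun hbad => by
  obtain ⟨J, hJ, hLJ⟩ := exists_mem_stopST hd hL.1 hbad
  exact hL.2 J hJ hLJ

end Stopping

section WeightDecay

variable {d n : ℕ} {p c₁ c₂ : ℝ} {W1p : (Fin d → ℝ) → Matrix (Fin n) (Fin n) ℂ}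
  {V : DCube d → Matrix (Fin n) (Fin n) ℂ}

/-- The decay lemma for the weighted stopping time. -/
lemma IsReducing.two_mul_volume_stopST_le (hV : IsReducing p c₁ c₂ W1p V) (hp : 1 < p)
    {l₁ L : ℝ} (hl0 : 0 < l₁) (hL : 0 < L) (hc₁ : 0 < c₁) (hc₂ : 0 < c₂) (hn : 0 < n)
    (hl₁ : 4 * (n : ℝ≥0∞) * ((n : ℝ≥0∞) ^ p * ENNReal.ofReal c₂ ^ p) ≤
      ENNReal.ofReal c₁ ^ p * ENNReal.ofReal l₁)
    (hL' : ENNReal.ofReal c₂ ^ p * ((n : ℝ≥0∞) ^ p * (n : ℝ≥0∞) ^ p) * 4 ^ (p - 1) ≤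
      ENNReal.ofReal c₁ ^ p * ENNReal.ofReal L ^ (p - 1))
    (hW : MatMeasurable W1p)
    (hpos : ∀ᵐ x ∂(volume : Measure (Fin d → ℝ)), (W1p x).PosDef) (hA : apNorm p W1p < ⊤)
    (I : DCube d) :
    2 * volume (⋃ J ∈ stopST p l₁ (L * (apNorm p W1p).toReal ^ (1 / (p - 1))) V I, J.set) ≤
      volume I.set := by
  classical
  set l₂ := L * (apNorm p W1p).toReal ^ (1 / (p - 1)) with hl₂
  have hst := isStopping_stopST (p := p) (l₁ := l₁) (l₂ := l₂) (V := V)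
  rw [measure_biUnion (Set.to_countable _) (hst I).2 fun J _ => J.measurableSet_set,
    ENNReal.tsum_eq_iSup_sum, ENNReal.mul_iSup]
  refine iSup_le fun s => ?_
  set t : Finset (DCube d) := s.map (Function.Embedding.subtype _) with ht
  have htmem : ∀ J ∈ t, J ∈ stopST p l₁ l₂ V I := fun J hJ => by
    obtain ⟨J', -, rfl⟩ := Finset.mem_map.1 hJ
    exact J'.2
  have hsum : ∑ J ∈ s, volume (J : DCube d).set = ∑ J ∈ t, volume J.set := by
    rw [ht, Finset.sum_map]
    rfl
  set a := t.filter fun J => l₁ < matNorm (V J * (V I)⁻¹) ^ p with ha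
  set b := t.filter fun J => ¬l₁ < matNorm (V J * (V I)⁻¹) ^ p with hb
  have hdisj : (t : Set (DCube d)).PairwiseDisjoint DCube.set :=
    fun J hJ K hK hne => (hst I).2 (htmem J hJ) (htmem K hK) hne
  have h1 : 4 * ∑ J ∈ a, volume J.set ≤ volume I.set :=
    hV.four_mul_sum_volume_le_of_norm (by linarith) hl0 hc₁ hl₁ I a
      (fun J hJ => (htmem J (Finset.mem_filter.1 hJ).1).1)
      (hdisj.subset (Finset.coe_subset.2 (Finset.filter_subset _ _)))
      fun J hJ => (Finset.mem_filter.1 hJ).2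
  have h2 : 4 * ∑ J ∈ b, volume J.set ≤ volume I.set :=
    hV.four_mul_sum_volume_le_of_inv_norm hp hL hc₁ hc₂ hn hL' hW hpos hA I b
      (fun J hJ => (htmem J (Finset.mem_filter.1 hJ).1).1)
      (hdisj.subset (Finset.coe_subset.2 (Finset.filter_subset _ _)))
      fun J hJ => (htmem J (Finset.mem_filter.1 hJ).1).2.1.resolve_left (Finset.mem_filter.1 hJ).2
  rw [hsum, ← Finset.sum_filter_add_sum_filter_not t fun J => l₁ < matNorm (V J * (V I)⁻¹) ^ p]
  refine (ENNReal.mul_le_mul_iff_right (a := 2) (by norm_num) (by norm_num)).1 ?_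
  calc _ = 4 * ∑ J ∈ a, volume J.set + 4 * ∑ J ∈ b, volume J.set := by ring
    _ ≤ volume I.set + volume I.set := add_le_add h1 h2
    _ = _ := by ring

lemma wMass_le_of_two_mul_volume_le (hp : 1 < p) (hW : MatMeasurable W1p)
    (hpos : ∀ᵐ x ∂(volume : Measure (Fin d → ℝ)), (W1p x).PosDef)
    (hA1 : 1 ≤ apNorm p W1p) (hA : apNorm p W1p < ⊤) (I : DCube d)
    (v : EuclideanSpace ℂ (Fin n)) {U : Set (Fin d → ℝ)} (hU : MeasurableSet U)
    (hUI : U ⊆ I.set) (hvol : 2 * volume U ≤ volume I.set) (hfin : wMass p W1p v I.set ≠ ⊤) :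
    wMass p W1p v U ≤
      ENNReal.ofReal (1 - 1 / (2 ^ p * (apNorm p W1p).toReal)) * wMass p W1p v I.set := by
  have hp0 : 0 < p := by linarith
  set A := apNorm p W1p with hAdef
  have ha : 0 < A.toReal := ENNReal.toReal_pos (zero_lt_one.trans_le hA1).ne' hA.ne
  set E := I.set \ U with hE
  have hEm : MeasurableSet E := I.measurableSet_set.diff hU
  have hsplit : wMass p W1p v U + wMass p W1p v E = wMass p W1p v I.set := by
    rw [wMass_eq_withDensity v hU, wMass_eq_withDensity v hEm,
      wMass_eq_withDensity v I.measurableSet_set, hE, measure_add_sdiff hU.nullMeasurableSet,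
      Set.union_eq_self_of_subset_left hUI]
  have hUE : volume U + volume E = volume I.set := by
    rw [hE, measure_add_sdiff hU.nullMeasurableSet, Set.union_eq_self_of_subset_left hUI]
  have hUt : volume U ≠ ⊤ := measure_ne_top_of_subset hUI I.volume_set_ne_top
  have hEt : volume E ≠ ⊤ := measure_ne_top_of_subset Set.sdiff_subset I.volume_set_ne_top
  have hI2E : volume I.set ≤ 2 * volume E := by
    rw [← hUE, two_mul]
    rw [← hUE, two_mul] at hvol
    exact add_le_add ((ENNReal.add_le_add_iff_left hUt).1 hvol) le_rfl
  have hE0 : volume E ≠ 0 := fun h => I.volume_set_ne_zero (by simpa [h] using hI2E)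
  have hUf : wMass p W1p v U ≠ ⊤ := ne_top_of_le_ne_top hfin (wMass_mono hUI)
  have hEf : wMass p W1p v E ≠ ⊤ := ne_top_of_le_ne_top hfin (wMass_mono Set.sdiff_subset)
  have hkey : wMass p W1p v I.set ≤ 2 ^ p * A * wMass p W1p v E := by
    refine (ENNReal.mul_le_mul_iff_right (a := volume E ^ p)
      (ENNReal.rpow_pos (pos_iff_ne_zero.2 hE0) hEt).ne'
      (ENNReal.rpow_ne_top_of_nonneg hp0.le hEt)).1 ?_
    calc _ ≤ volume I.set ^ p * A * wMass p W1p v E :=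
          volume_rpow_mul_wMass_le hp hW hpos I v hEm Set.sdiff_subset hEf
      _ ≤ (2 * volume E) ^ p * A * wMass p W1p v E := by gcongr
      _ = _ := by
          rw [ENNReal.mul_rpow_of_nonneg _ _ hp0.le]
          ring
  have hkey' := ENNReal.toReal_mono (ENNReal.mul_ne_top (ENNReal.mul_ne_top
    (ENNReal.rpow_ne_top_of_nonneg hp0.le (by norm_num)) hA.ne) hEf) hkey
  have hsplit' := congrArg ENNReal.toReal hsplit
  rw [ENNReal.toReal_add hUf hEf] at hsplit'
  rw [ENNReal.toReal_mul, ENNReal.toReal_mul, ← ENNReal.toReal_rpow, ENNReal.toReal_ofNat] at hkey'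
  have hle : 1 / (2 ^ p * A.toReal) ≤ 1 := by
    rw [div_le_one (by positivity)]
    have h1 : 1 ≤ A.toReal := by
      simpa using ENNReal.toReal_mono hA.ne hA1
    have h2 : (1 : ℝ) ≤ 2 ^ p := Real.one_le_rpow (by norm_num) hp0.le
    nlinarith
  rw [← ENNReal.ofReal_toReal hUf, ← ENNReal.ofReal_toReal hfin,
    ← ENNReal.ofReal_mul (by linarith)]
  refine ENNReal.ofReal_le_ofReal ?_
  have h3 : 1 / (2 ^ p * A.toReal) * (wMass p W1p v I.set).toReal ≤ (wMass p W1p v E).toReal := by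
    rw [one_div, inv_mul_le_iff₀ (by positivity)]
    exact hkey'
  nlinarith

lemma one_sub_pow_le_two_rpow {p a : ℝ} (hp : 1 < p) (ha : 1 ≤ a) (m : ℕ) :
    (1 - 1 / (2 ^ p * a)) ^ m ≤ (2 : ℝ) ^ (-((m : ℝ) / (p * 2 ^ p * a + 1))) := by
  have hb : 1 ≤ (2 : ℝ) ^ p * a := one_le_mul_of_one_le_of_one_le
    (Real.one_le_rpow (by norm_num) (by linarith)) ha
  set b := (2 : ℝ) ^ p * a with hbdef
  have hb0 : 0 < b := by linarith
  have e : p * 2 ^ p * a = p * b := by rw [hbdef]; ring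
  rw [e]
  have h1 : 1 - 1 / b ≤ Real.exp (-(1 / b)) := by
    have := Real.add_one_le_exp (-(1 / b))
    linarith
  have h0 : 0 ≤ 1 - 1 / b := by
    rw [sub_nonneg, div_le_one hb0]
    exact hb
  calc (1 - 1 / b) ^ m ≤ Real.exp (-(1 / b)) ^ m := pow_le_pow_left₀ h0 h1 m
    _ = Real.exp (m * -(1 / b)) := (Real.exp_nat_mul _ _).symm
    _ ≤ Real.exp (Real.log 2 * -((m : ℝ) / (p * b + 1))) := by
        refine Real.exp_le_exp.2 ?_
        have hlog : Real.log 2 ≤ 1 := by linarith [Real.log_two_lt_d9]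
        have h2 : Real.log 2 * ((m : ℝ) / (p * b + 1)) ≤ m * (1 / b) := by
          rw [mul_one_div, ← mul_div_assoc, div_le_div_iff₀ (by positivity) hb0]
          have hm : (0 : ℝ) ≤ m := by positivity
          have h3 : Real.log 2 * b ≤ p * b + 1 := by nlinarith
          nlinarith
        linarith
    _ = _ := by rw [Real.rpow_def_of_pos (by norm_num)]

end WeightDecay

/-! ## Finite Haar expansions -/

section FiniteHaarSums

variable {d n : ℕ}

lemma haarCoef_eq_zero_of_const {f : (Fin d → ℝ) → EuclideanSpace ℂ (Fin n)} {I : DCube d}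
    {v : EuclideanSpace ℂ (Fin n)} (hf : ∀ x ∈ I.set, f x = v) {ε : Fin d → Bool}
    (hε : ε ∈ Sfin d) : haarCoef f I ε = 0 := by
  have h : ∀ x, haarFn I ε x • f x = haarFn I ε x • v := by
    intro x
    by_cases hx : x ∈ I.set
    · rw [hf x hx]
    · rw [haarFn_eq_zero ε hx, zero_smul, zero_smul]
  simp only [haarCoef, h]
  rw [integral_smul_const, integral_haarFn hε, zero_smul]

lemma FiniteHaar.exists_haarCoef_eq_zero {f : (Fin d → ℝ) → EuclideanSpace ℂ (Fin n)}
    (hf : FiniteHaar f) :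
    ∃ N : ℤ, ∀ I : DCube d, I.k < N → ∀ ε ∈ Sfin d, haarCoef f I ε = 0 := by
  obtain ⟨F, hF⟩ := hf
  obtain ⟨N, hN⟩ := (F.image fun q => -q.1.k).exists_le
  refine ⟨-N, fun I hI ε hε => haarCoef_eq_zero_of_const (v := f I.corner) (fun x hx => ?_) hε⟩
  rw [hF x, hF I.corner]
  refine Finset.sum_congr rfl fun q hq => ?_
  have hk : I.k < q.1.k := by
    have := hN _ (Finset.mem_image_of_mem (fun q => -q.1.k) hq)
    omega
  rw [haarFn_congr q.2 hk hx I.corner_mem]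

lemma haarBlock_eq_zero_of_coef {I : DCube d} {c : (Fin d → Bool) → EuclideanSpace ℂ (Fin n)}
    (hc : ∀ ε ∈ Sfin d, c ε = 0) (x : Fin d → ℝ) : haarBlock I c x = 0 :=
  Finset.sum_eq_zero fun ε hε => by rw [hc ε hε, smul_zero]

lemma mApp_haarBlock (M : Matrix (Fin n) (Fin n) ℂ) (I : DCube d)
    (c : (Fin d → Bool) → EuclideanSpace ℂ (Fin n)) (x : Fin d → ℝ) :
    mApp M (haarBlock I c x) = haarBlock I (fun ε => mApp M (c ε)) x := by
  simp only [haarBlock, mApp_sum, mApp_real_smul]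

lemma haarBlock_smul (r : ℝ) (I : DCube d) (c : (Fin d → Bool) → EuclideanSpace ℂ (Fin n))
    (x : Fin d → ℝ) : haarBlock I (fun ε => r • c ε) x = r • haarBlock I c x := by
  simp only [haarBlock, Finset.smul_sum, smul_comm r]

variable {𝒥 : DCube d → Set (DCube d)}

lemma haarBlock_congr_of_mem_Fcol {K J I : DCube d} (hI : I ∈ Fcol 𝒥 K) (hJ : J ∈ 𝒥 K)
    (c : (Fin d → Bool) → EuclideanSpace ℂ (Fin n)) {x y : Fin d → ℝ} (hx : x ∈ J.set)
    (hy : y ∈ J.set) : haarBlock I c x = haarBlock I c y := by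
  rcases le_or_gt I.k J.k with h | h
  · have hdisj := Set.disjoint_right.1 (DCube.disjoint_of_not_subset h (hI.2 J hJ))
    rw [haarBlock_eq_zero c (hdisj hx), haarBlock_eq_zero c (hdisj hy)]
  · exact haarBlock_congr c h hx hy

lemma IsStopping.tsum_Fj_haarBlock (h : IsStopping 𝒥) {I₀ K : DCube d} {j : ℕ}
    (hK : K ∈ JIter 𝒥 (j - 1) I₀) {c : DCube d → (Fin d → Bool) → EuclideanSpace ℂ (Fin n)}
    {N : ℤ} {s : Finset (DCube d)} (hs : ∀ I, I ∈ s ↔ N ≤ I.k ∧ I ∈ Fcol 𝒥 K)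
    (hc : ∀ I, I.k < N → ∀ ε ∈ Sfin d, c I ε = 0) {x : Fin d → ℝ} (hx : x ∈ K.set) :
    ∑' I : Fj 𝒥 I₀ j, haarBlock (I : DCube d) (c I) x = ∑ I ∈ s, haarBlock I (c I) x := by
  rw [tsum_subtype (Fj 𝒥 I₀ j) fun I => haarBlock I (c I) x, tsum_eq_sum (s := s)]
  · refine Finset.sum_congr rfl fun I hI => Set.indicator_of_mem ?_ _
    exact Set.mem_biUnion hK ((hs I).1 hI).2
  · intro I hI
    refine Set.indicator_apply_eq_zero.2 fun hIF => ?_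
    obtain ⟨K', hK', hIK'⟩ := Set.mem_iUnion₂.1 hIF
    rcases lt_or_ge I.k N with hN | hN
    · exact haarBlock_eq_zero_of_coef (hc I hN) x
    · refine haarBlock_eq_zero _ fun hxI => hI ((hs I).2 ⟨hN, ?_⟩)
      rcases eq_or_ne K K' with rfl | hne
      · exact hIK'
      · exact absurd (hIK'.1 hxI)
          (Set.disjoint_left.1 (h.pairwiseDisjoint_JIter _ _ hK hK' hne) hx)

end FiniteHaarSums

/-! ## The local estimate on a stopping cube -/

section LocalEstimate

variable {d n : ℕ} {p c₁ c₂ l₁ l₂ : ℝ} {W1p : (Fin d → ℝ) → Matrix (Fin n) (Fin n) ℂ}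
  {V : DCube d → Matrix (Fin n) (Fin n) ℂ}

lemma not_stopBad_parent (hd : 0 < d) {K J : DCube d} (hJ : J ∈ stopST p l₁ l₂ V K)
    (hne : J ≠ K) : J.parent.set ⊆ K.set ∧ ¬stopBad p l₁ l₂ V J.parent K := by
  have hsub := DCube.parent_subset hd hJ.1 hne
  refine ⟨hsub, fun hbad => ?_⟩
  have := congrArg DCube.k (hJ.2.2 _ hsub hbad J.subset_parent)
  simp [DCube.parent] at this

lemma IsReducing.volume_mul_le_of_mem_stopST (hV : IsReducing p c₁ c₂ W1p V) (hp : 0 < p)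
    (hd : 0 < d) (hl₁ : 0 ≤ l₁) {K J : DCube d} (hJ : J ∈ stopST p l₁ l₂ V K) (hne : J ≠ K)
    (v : EuclideanSpace ℂ (Fin n)) :
    ENNReal.ofReal c₁ ^ p * (volume J.set * ENNReal.ofReal ‖mApp (V J) v‖ ^ p) ≤
      ENNReal.ofReal c₂ ^ p * 2 ^ d * ENNReal.ofReal l₁ *
        (volume J.set * ENNReal.ofReal ‖mApp (V K) v‖ ^ p) := by
  obtain ⟨-, hbad⟩ := not_stopBad_parent hd hJ hne
  have hl : matNorm (V J.parent * (V K)⁻¹) ^ p ≤ l₁ := not_lt.1 fun h => hbad (Or.inl h)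
  have h1 : ENNReal.ofReal ‖mApp (V J.parent) v‖ ^ p ≤
      ENNReal.ofReal l₁ * ENNReal.ofReal ‖mApp (V K) v‖ ^ p := by
    rw [ENNReal.ofReal_rpow_of_nonneg (norm_nonneg _) hp.le,
      ENNReal.ofReal_rpow_of_nonneg (norm_nonneg _) hp.le, ← ENNReal.ofReal_mul hl₁]
    refine ENNReal.ofReal_le_ofReal ?_
    calc ‖mApp (V J.parent) v‖ ^ p
        = ‖mApp (V J.parent * (V K)⁻¹) (mApp (V K) v)‖ ^ p := by
          rw [mApp_mul, mApp_inv_mApp (hV K).1]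
      _ ≤ (matNorm (V J.parent * (V K)⁻¹) * ‖mApp (V K) v‖) ^ p :=
          Real.rpow_le_rpow (norm_nonneg _) (norm_mApp_le _ _) hp.le
      _ = matNorm (V J.parent * (V K)⁻¹) ^ p * ‖mApp (V K) v‖ ^ p :=
          Real.mul_rpow (matNorm_nonneg _) (norm_nonneg _)
      _ ≤ _ := by gcongr
  have h2 : volume J.parent.set = 2 ^ d * volume J.set := by
    rw [DCube.volume_set, DCube.volume_set, DCube.vol_parent, ENNReal.ofReal_mul (by positivity),
      ENNReal.ofReal_pow (by norm_num), ENNReal.ofReal_ofNat]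
  calc _ ≤ ENNReal.ofReal c₂ ^ p *
        (volume J.parent.set * ENNReal.ofReal ‖mApp (V J.parent) v‖ ^ p) :=
        hV.comparison hp J.subset_parent v
    _ ≤ ENNReal.ofReal c₂ ^ p * (2 ^ d * volume J.set *
          (ENNReal.ofReal l₁ * ENNReal.ofReal ‖mApp (V K) v‖ ^ p)) := by
        rw [h2]
        gcongr
    _ = _ := by ring

lemma matNorm_mul_inv_le_of_mem_Fcol (hV : IsReducing p c₁ c₂ W1p V) (hp : 1 < p) (hd : 0 < d)
    {K I : DCube d} (hI : I ∈ Fcol (stopST p l₁ l₂ V) K) :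
    matNorm (V K * (V I)⁻¹) ≤ l₂ ^ ((p - 1) / p) := by
  have hp1 : 0 < p - 1 := by linarith
  have hp0 : 0 < p := by linarith
  have h : matNorm ((V I)⁻¹ * V K) ^ (p / (p - 1)) ≤ l₂ :=
    not_lt.1 fun h => not_stopBad_of_mem_Fcol hd hI (Or.inr h)
  rw [matNorm_inv_mul (hV K).1 (hV I).1] at h
  have h' := Real.rpow_le_rpow (Real.rpow_nonneg (matNorm_nonneg _) _) h (div_pos hp1 hp0).le
  rwa [← Real.rpow_mul (matNorm_nonneg _), div_mul_div_cancel₀ hp1.ne', div_self hp0.ne',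
    Real.rpow_one] at h'

/-- `L^p` bound for `∑ V_K V_I⁻¹ f_I` over cubes in `ℱ(K)`. -/
lemma lintegral_mApp_sum_le (hV : IsReducing p c₁ c₂ W1p V) (hp : 1 < p) (hd : 0 < d)
    (hl₂ : 0 ≤ l₂) {B : ℝ≥0∞}
    (hB : ∀ (K : DCube d) (s : Finset (DCube d))
      (c c' : DCube d → (Fin d → Bool) → EuclideanSpace ℂ (Fin n)),
      (∀ I ∈ s, I.set ⊆ K.set) →
      (∀ I ∈ s, ∀ x, ‖haarBlock I (c' I) x‖ ≤ ‖haarBlock I (c I) x‖) →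
      ∫⁻ x in K.set, ENNReal.ofReal ‖∑ I ∈ s, haarBlock I (c' I) x‖ ^ p ≤
        B * ∫⁻ x in K.set, ENNReal.ofReal ‖∑ I ∈ s, haarBlock I (c I) x‖ ^ p)
    (K : DCube d) (s : Finset (DCube d)) (hs : ∀ I ∈ s, I ∈ Fcol (stopST p l₁ l₂ V) K)
    (c : DCube d → (Fin d → Bool) → EuclideanSpace ℂ (Fin n)) :
    ∫⁻ x in K.set, ENNReal.ofReal
        ‖mApp (V K) (∑ I ∈ s, haarBlock I (fun ε => mApp (V I)⁻¹ (c I ε)) x)‖ ^ p ≤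
      B * ENNReal.ofReal (l₂ ^ (p - 1)) *
        ∫⁻ x in K.set, ENNReal.ofReal ‖∑ I ∈ s, haarBlock I (c I) x‖ ^ p := by
  have hp0 : 0 < p := by linarith
  set Λ := l₂ ^ ((p - 1) / p) with hΛ
  have hΛ0 : 0 ≤ Λ := by positivity
  have hΛp : ENNReal.ofReal Λ ^ p = ENNReal.ofReal (l₂ ^ (p - 1)) := by
    rw [ENNReal.ofReal_rpow_of_nonneg hΛ0 hp0.le, hΛ, ← Real.rpow_mul hl₂,
      div_mul_cancel₀ _ hp0.ne']
  have h := hB K s (fun I ε => Λ • c I ε) (fun I ε => mApp (V K * (V I)⁻¹) (c I ε))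
    (fun I hI => (hs I hI).1) fun I hI x => by
      rw [← mApp_haarBlock, haarBlock_smul, norm_smul, Real.norm_of_nonneg hΛ0]
      refine (norm_mApp_le _ _).trans ?_
      gcongr
      exact matNorm_mul_inv_le_of_mem_Fcol hV hp hd (hs I hI)
  calc _ = ∫⁻ x in K.set, ENNReal.ofReal
        ‖∑ I ∈ s, haarBlock I (fun ε => mApp (V K * (V I)⁻¹) (c I ε)) x‖ ^ p := by
        simp only [mApp_sum, mApp_haarBlock, mApp_mul]
    _ ≤ _ := h
    _ = B * ∫⁻ x in K.set, ENNReal.ofReal Λ ^ p *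
          ENNReal.ofReal ‖∑ I ∈ s, haarBlock I (c I) x‖ ^ p := by
        congr 1
        refine lintegral_congr fun x => ?_
        simp only [haarBlock_smul]
        rw [← Finset.smul_sum, norm_smul, Real.norm_of_nonneg hΛ0, ENNReal.ofReal_mul hΛ0,
          ENNReal.mul_rpow_of_nonneg _ _ hp0.le]
    _ = _ := by
        rw [lintegral_const_mul' _ _ (ofReal_rpow_ne_top hp0.le), hΛp, mul_assoc]

lemma IsReducing.lintegral_JIter_le (hV : IsReducing p c₁ c₂ W1p V) (hp : 1 < p) (hd : 0 < d)
    (hl₁ : 0 ≤ l₁) (hl₂ : 0 ≤ l₂) {B θ : ℝ≥0∞}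
    (hB : ∀ (K : DCube d) (s : Finset (DCube d))
      (c c' : DCube d → (Fin d → Bool) → EuclideanSpace ℂ (Fin n)),
      (∀ I ∈ s, I.set ⊆ K.set) →
      (∀ I ∈ s, ∀ x, ‖haarBlock I (c' I) x‖ ≤ ‖haarBlock I (c I) x‖) →
      ∫⁻ x in K.set, ENNReal.ofReal ‖∑ I ∈ s, haarBlock I (c' I) x‖ ^ p ≤
        B * ∫⁻ x in K.set, ENNReal.ofReal ‖∑ I ∈ s, haarBlock I (c I) x‖ ^ p)
    (hvol : ∀ I, 2 * volume (⋃ J ∈ stopST p l₁ l₂ V I, J.set) ≤ volume I.set)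
    (hθ : ∀ v I, wMass p W1p v (⋃ J ∈ stopST p l₁ l₂ V I, J.set) ≤ θ * wMass p W1p v I.set)
    (m : ℕ) (K : DCube d) (s : Finset (DCube d))
    (hs : ∀ I ∈ s, I ∈ Fcol (stopST p l₁ l₂ V) K)
    (c : DCube d → (Fin d → Bool) → EuclideanSpace ℂ (Fin n)) :
    ENNReal.ofReal c₁ ^ p * ENNReal.ofReal c₁ ^ p *
      ∫⁻ x in ⋃ J ∈ JIter (stopST p l₁ l₂ V) (1 + m) K, J.set, ENNReal.ofReal
        ‖mApp (W1p x) (∑ I ∈ s, haarBlock I (fun ε => mApp (V I)⁻¹ (c I ε)) x)‖ ^ p ≤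
      θ ^ m * (ENNReal.ofReal c₂ ^ p * 2 ^ d * ENNReal.ofReal l₁) *
        (B * ENNReal.ofReal (l₂ ^ (p - 1)) *
          ∫⁻ x in K.set, ENNReal.ofReal ‖∑ I ∈ s, haarBlock I (c I) x‖ ^ p) := by
  have hp0 : 0 < p := by linarith
  have hst := isStopping_stopST (p := p) (l₁ := l₁) (l₂ := l₂) (V := V)
  set 𝒥 := stopST p l₁ l₂ V with h𝒥
  set g := fun x => ∑ I ∈ s, haarBlock I (fun ε => mApp (V I)⁻¹ (c I ε)) x with hg
  set α := ENNReal.ofReal c₁ ^ p with hα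
  have hαt : α ≠ ⊤ := ofReal_rpow_ne_top hp0.le
  set D := ENNReal.ofReal c₂ ^ p * 2 ^ d * ENNReal.ofReal l₁ with hD
  have hKK : K ∉ 𝒥 K := by
    intro hK
    have h1 : 2 * volume K.set ≤ volume K.set :=
      le_trans (mul_le_mul' le_rfl (measure_mono (Set.subset_biUnion_of_mem hK))) (hvol K)
    rw [two_mul] at h1
    exact absurd h1 (not_le.2 (ENNReal.lt_add_right K.volume_set_ne_top K.volume_set_ne_zero))
  have hunion : ⋃ J ∈ JIter 𝒥 (1 + m) K, J.set = ⋃ J : 𝒥 K, ⋃ L ∈ JIter 𝒥 m J, L.set := by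
    ext x
    simp only [Set.mem_iUnion, mem_JIter_one_add, exists_prop, Subtype.exists]
    constructor
    · rintro ⟨L, ⟨J, hJ, hL⟩, hx⟩
      exact ⟨J, hJ, L, hL, hx⟩
    · rintro ⟨J, hJ, L, hL, hx⟩
      exact ⟨L, ⟨J, hJ, hL⟩, hx⟩
  have hgJ : ∀ J ∈ 𝒥 K, ∀ x ∈ J.set, g x = g J.corner := fun J hJ x hx =>
    Finset.sum_congr rfl fun I hI => haarBlock_congr_of_mem_Fcol (hs I hI) hJ _ hx J.corner_mem
  have hlocal : ∀ J : 𝒥 K, α * α * ∫⁻ x in ⋃ L ∈ JIter 𝒥 m J, L.set,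
        ENNReal.ofReal ‖mApp (W1p x) (g x)‖ ^ p ≤
      θ ^ m * D * ∫⁻ x in (J : DCube d).set, ENNReal.ofReal ‖mApp (V K) (g x)‖ ^ p := by
    rintro ⟨J, hJ⟩
    simp only
    have hU := measurableSet_biUnion_cubes (JIter 𝒥 m J)
    have hUJ : ⋃ L ∈ JIter 𝒥 m J, L.set ⊆ J.set :=
      Set.iUnion₂_subset fun L hL => hst.JIter_subset hL
    have hne : J ≠ K := fun h => hKK (h ▸ hJ)
    set e := g J.corner with he
    have h1 : ∫⁻ x in ⋃ L ∈ JIter 𝒥 m J, L.set, ENNReal.ofReal ‖mApp (W1p x) (g x)‖ ^ p =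
        wMass p W1p e (⋃ L ∈ JIter 𝒥 m J, L.set) :=
      setLIntegral_congr_fun hU fun x hx => by
        rw [hgJ J hJ x (hUJ hx)]
    have h2 : ∫⁻ x in J.set, ENNReal.ofReal ‖mApp (V K) (g x)‖ ^ p =
        volume J.set * ENNReal.ofReal ‖mApp (V K) e‖ ^ p := by
      rw [mul_comm, ← setLIntegral_const]
      exact setLIntegral_congr_fun J.measurableSet_set fun x hx => by
        rw [hgJ J hJ x hx]
    have h3 : wMass p W1p e (⋃ L ∈ JIter 𝒥 m J, L.set) ≤ θ ^ m * wMass p W1p e J.set := by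
      rw [wMass_eq_withDensity e hU, wMass_eq_withDensity e J.measurableSet_set]
      refine hst.measure_JIter_le _ (fun I => ?_) m J
      rw [← wMass_eq_withDensity e (measurableSet_biUnion_cubes _),
        ← wMass_eq_withDensity e I.measurableSet_set]
      exact hθ e I
    rw [h1, h2]
    calc _ ≤ α * α * (θ ^ m * wMass p W1p e J.set) := mul_le_mul' le_rfl h3
      _ = θ ^ m * (α * (α * wMass p W1p e J.set)) := by ring
      _ ≤ θ ^ m * (α * (volume J.set * ENNReal.ofReal ‖mApp (V J) e‖ ^ p)) :=
          mul_le_mul' le_rfl (mul_le_mul' le_rfl (hV.wMass_le hp0 J e))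
      _ ≤ θ ^ m * (D * (volume J.set * ENNReal.ofReal ‖mApp (V K) e‖ ^ p)) :=
          mul_le_mul' le_rfl (hV.volume_mul_le_of_mem_stopST hp0 hd hl₁ hJ hne e)
      _ = _ := by ring
  calc _ ≤ α * α * ∑' J : 𝒥 K, ∫⁻ x in ⋃ L ∈ JIter 𝒥 m J, L.set,
        ENNReal.ofReal ‖mApp (W1p x) (g x)‖ ^ p := by
        rw [hunion]
        exact mul_le_mul' le_rfl (lintegral_iUnion_le _ _)
    _ ≤ ∑' J : 𝒥 K, θ ^ m * D *
          ∫⁻ x in (J : DCube d).set, ENNReal.ofReal ‖mApp (V K) (g x)‖ ^ p := by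
        rw [← ENNReal.tsum_mul_left]
        exact ENNReal.tsum_le_tsum hlocal
    _ = θ ^ m * D * ∫⁻ x in ⋃ J : 𝒥 K, (J : DCube d).set,
          ENNReal.ofReal ‖mApp (V K) (g x)‖ ^ p := by
        rw [ENNReal.tsum_mul_left, lintegral_iUnion (fun J => DCube.measurableSet_set _)]
        exact fun J J' hne => (hst K).2 J.2 J'.2 fun h => hne (Subtype.ext h)
    _ ≤ θ ^ m * D * ∫⁻ x in K.set, ENNReal.ofReal ‖mApp (V K) (g x)‖ ^ p :=
        mul_le_mul' le_rfl (lintegral_mono_set (Set.iUnion_subset fun J => J.2.1))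
    _ ≤ _ := mul_le_mul' le_rfl (lintegral_mApp_sum_le hV hp hd hl₂ hB K s hs c)

end LocalEstimate

/-! ## The global estimate -/

section GlobalEstimate

variable {d n : ℕ} {p c₁ c₂ l₁ l₂ : ℝ} {W1p : (Fin d → ℝ) → Matrix (Fin n) (Fin n) ℂ}
  {V : DCube d → Matrix (Fin n) (Fin n) ℂ}

lemma IsReducing.lintegral_projInv_le (hV : IsReducing p c₁ c₂ W1p V) (hp : 1 < p) (hd : 0 < d)
    (hl₁ : 0 ≤ l₁) (hl₂ : 0 ≤ l₂) {B θ : ℝ≥0∞}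
    (hB : ∀ (K : DCube d) (s : Finset (DCube d))
      (c c' : DCube d → (Fin d → Bool) → EuclideanSpace ℂ (Fin n)),
      (∀ I ∈ s, I.set ⊆ K.set) →
      (∀ I ∈ s, ∀ x, ‖haarBlock I (c' I) x‖ ≤ ‖haarBlock I (c I) x‖) →
      ∫⁻ x in K.set, ENNReal.ofReal ‖∑ I ∈ s, haarBlock I (c' I) x‖ ^ p ≤
        B * ∫⁻ x in K.set, ENNReal.ofReal ‖∑ I ∈ s, haarBlock I (c I) x‖ ^ p)
    (hvol : ∀ I, 2 * volume (⋃ J ∈ stopST p l₁ l₂ V I, J.set) ≤ volume I.set)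
    (hθ : ∀ v I, wMass p W1p v (⋃ J ∈ stopST p l₁ l₂ V I, J.set) ≤ θ * wMass p W1p v I.set)
    (I₀ : DCube d) (j m : ℕ) {f : (Fin d → ℝ) → EuclideanSpace ℂ (Fin n)} (hf : FiniteHaar f) :
    ENNReal.ofReal c₁ ^ p * ENNReal.ofReal c₁ ^ p *
      ∫⁻ x in ⋃ J ∈ JIter (stopST p l₁ l₂ V) (j - 1 + (1 + m)) I₀, J.set, ENNReal.ofReal
        ‖mApp (W1p x) (projInv V (Fj (stopST p l₁ l₂ V) I₀ j) f x)‖ ^ p ≤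
      θ ^ m * (ENNReal.ofReal c₂ ^ p * 2 ^ d * ENNReal.ofReal l₁) *
        (B * ENNReal.ofReal (l₂ ^ (p - 1)) *
          ∫⁻ x, ENNReal.ofReal ‖deltaHaar (stopST p l₁ l₂ V) I₀ j f x‖ ^ p) := by
  have hst := isStopping_stopST (p := p) (l₁ := l₁) (l₂ := l₂) (V := V)
  set 𝒥 := stopST p l₁ l₂ V with h𝒥
  set D := ENNReal.ofReal c₂ ^ p * 2 ^ d * ENNReal.ofReal l₁ with hD
  set α := ENNReal.ofReal c₁ ^ p with hα
  obtain ⟨N, hN⟩ := hf.exists_haarCoef_eq_zero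
  have hunion : ⋃ J ∈ JIter 𝒥 (j - 1 + (1 + m)) I₀, J.set =
      ⋃ K : JIter 𝒥 (j - 1) I₀, ⋃ L ∈ JIter 𝒥 (1 + m) K, L.set := by
    ext x
    simp only [Set.mem_iUnion, mem_JIter_add (b := 1 + m), exists_prop, Subtype.exists]
    constructor
    · rintro ⟨L, ⟨J, hJ, hL⟩, hx⟩
      exact ⟨J, hJ, L, hL, hx⟩
    · rintro ⟨J, hJ, L, hL, hx⟩
      exact ⟨L, ⟨J, hJ, hL⟩, hx⟩
  have hlocal : ∀ K : JIter 𝒥 (j - 1) I₀,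
      α * α * ∫⁻ x in ⋃ L ∈ JIter 𝒥 (1 + m) K, L.set,
        ENNReal.ofReal ‖mApp (W1p x) (projInv V (Fj 𝒥 I₀ j) f x)‖ ^ p ≤
      θ ^ m * D * (B * ENNReal.ofReal (l₂ ^ (p - 1)) *
        ∫⁻ x in (K : DCube d).set, ENNReal.ofReal ‖deltaHaar 𝒥 I₀ j f x‖ ^ p) := by
    rintro ⟨K, hK⟩
    have hfin : {I : DCube d | N ≤ I.k ∧ I ∈ Fcol 𝒥 K}.Finite :=
      (DCube.finite_subcubes hd K N).subset fun I hI => ⟨hI.1, hI.2.1⟩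
    have hs : ∀ I, I ∈ hfin.toFinset ↔ N ≤ I.k ∧ I ∈ Fcol 𝒥 K := fun I => by simp
    have hproj : ∀ x ∈ K.set, projInv V (Fj 𝒥 I₀ j) f x =
        ∑ I ∈ hfin.toFinset, haarBlock I (fun ε => mApp (V I)⁻¹ (haarCoef f I ε)) x :=
      fun x hx => hst.tsum_Fj_haarBlock (c := fun I ε => mApp (V I)⁻¹ (haarCoef f I ε)) hK hs
        (fun I hI ε hε => by simp [hN I hI ε hε, mApp]) hx
    have hdelta : ∀ x ∈ K.set, deltaHaar 𝒥 I₀ j f x =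
        ∑ I ∈ hfin.toFinset, haarBlock I (haarCoef f I) x :=
      fun x hx => hst.tsum_Fj_haarBlock (c := haarCoef f) hK hs hN hx
    have hUK : ⋃ L ∈ JIter 𝒥 (1 + m) K, L.set ⊆ K.set :=
      Set.iUnion₂_subset fun L hL => hst.JIter_subset hL
    calc _ = α * α * ∫⁻ x in ⋃ L ∈ JIter 𝒥 (1 + m) K, L.set, ENNReal.ofReal ‖mApp (W1p x)
          (∑ I ∈ hfin.toFinset, haarBlock I (fun ε => mApp (V I)⁻¹ (haarCoef f I ε)) x)‖ ^ p := by
          congr 1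
          exact setLIntegral_congr_fun (measurableSet_biUnion_cubes _) fun x hx => by
            rw [hproj x (hUK hx)]
      _ ≤ θ ^ m * D * (B * ENNReal.ofReal (l₂ ^ (p - 1)) * ∫⁻ x in K.set,
            ENNReal.ofReal ‖∑ I ∈ hfin.toFinset, haarBlock I (haarCoef f I) x‖ ^ p) :=
          hV.lintegral_JIter_le hp hd hl₁ hl₂ hB hvol hθ m K _ (fun I hI => ((hs I).1 hI).2) _
      _ = _ := by
          congr 2
          exact setLIntegral_congr_fun K.measurableSet_set fun x hx => by rw [hdelta x hx]
  calc _ ≤ α * α * ∑' K : JIter 𝒥 (j - 1) I₀, ∫⁻ x in ⋃ L ∈ JIter 𝒥 (1 + m) K, L.set,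
        ENNReal.ofReal ‖mApp (W1p x) (projInv V (Fj 𝒥 I₀ j) f x)‖ ^ p := by
        rw [hunion]
        exact mul_le_mul' le_rfl (lintegral_iUnion_le _ _)
    _ ≤ ∑' K : JIter 𝒥 (j - 1) I₀, θ ^ m * D * (B * ENNReal.ofReal (l₂ ^ (p - 1)) *
        ∫⁻ x in (K : DCube d).set, ENNReal.ofReal ‖deltaHaar 𝒥 I₀ j f x‖ ^ p) := by
        rw [← ENNReal.tsum_mul_left]
        exact ENNReal.tsum_le_tsum hlocal
    _ = θ ^ m * D * (B * ENNReal.ofReal (l₂ ^ (p - 1)) *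
        ∫⁻ x in ⋃ K : JIter 𝒥 (j - 1) I₀, (K : DCube d).set,
          ENNReal.ofReal ‖deltaHaar 𝒥 I₀ j f x‖ ^ p) := by
        rw [ENNReal.tsum_mul_left, ENNReal.tsum_mul_left,
          lintegral_iUnion (fun K => DCube.measurableSet_set _)]
        exact fun K K' hne => hst.pairwiseDisjoint_JIter _ _ K.2 K'.2 fun h => hne (Subtype.ext h)
    _ ≤ _ := mul_le_mul' le_rfl (mul_le_mul' le_rfl (setLIntegral_le_lintegral _ _))

end GlobalEstimate

/-! ## Choice of the stopping constants -/

lemma exists_stopping_constants (n : ℕ) (hn : 0 < n) {p c₁ c₂ : ℝ} (hp : 1 < p) (hc₁ : 0 < c₁)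
    (hc₂ : 0 < c₂) : ∃ l₁ L : ℝ, 1 < l₁ ∧ 0 < L ∧
      4 * (n : ℝ≥0∞) * ((n : ℝ≥0∞) ^ p * ENNReal.ofReal c₂ ^ p) ≤
        ENNReal.ofReal c₁ ^ p * ENNReal.ofReal l₁ ∧
      ENNReal.ofReal c₂ ^ p * ((n : ℝ≥0∞) ^ p * (n : ℝ≥0∞) ^ p) * 4 ^ (p - 1) ≤
        ENNReal.ofReal c₁ ^ p * ENNReal.ofReal L ^ (p - 1) := by
  have hp1 : 0 < p - 1 := by linarith
  have hn' : (0 : ℝ) < n := Nat.cast_pos.2 hn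
  have hα : 0 < c₁ ^ p := Real.rpow_pos_of_pos hc₁ p
  have hβ : 0 < c₂ ^ p := Real.rpow_pos_of_pos hc₂ p
  have hν : 0 < (n : ℝ) ^ p := Real.rpow_pos_of_pos hn' p
  set X := c₂ ^ p * ((n : ℝ) ^ p * (n : ℝ) ^ p) * 4 ^ (p - 1) / c₁ ^ p with hX
  have hX0 : 0 < X := by positivity
  refine ⟨1 + 4 * n * ((n : ℝ) ^ p * c₂ ^ p) / c₁ ^ p, X ^ (p - 1)⁻¹, ?_, by positivity, ?_, ?_⟩
  · have : 0 < 4 * n * ((n : ℝ) ^ p * c₂ ^ p) / c₁ ^ p := by positivity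
    linarith
  · rw [← ENNReal.ofReal_natCast n, ← ENNReal.ofReal_ofNat 4, ENNReal.ofReal_rpow_of_pos hn',
      ENNReal.ofReal_rpow_of_pos hc₁, ENNReal.ofReal_rpow_of_pos hc₂,
      ← ENNReal.ofReal_mul (by positivity), ← ENNReal.ofReal_mul (by positivity),
      ← ENNReal.ofReal_mul (by positivity), ← ENNReal.ofReal_mul (by positivity), mul_add,
      mul_div_cancel₀ _ hα.ne']
    exact ENNReal.ofReal_le_ofReal (by linarith)
  · rw [← ENNReal.ofReal_natCast n, ← ENNReal.ofReal_ofNat 4, ENNReal.ofReal_rpow_of_pos hn',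
      ENNReal.ofReal_rpow_of_pos hc₁, ENNReal.ofReal_rpow_of_pos hc₂,
      ENNReal.ofReal_rpow_of_pos (by norm_num), ENNReal.ofReal_rpow_of_pos (by positivity),
      Real.rpow_inv_rpow hX0.le hp1.ne',
      ← ENNReal.ofReal_mul (by positivity), ← ENNReal.ofReal_mul (by positivity),
      ← ENNReal.ofReal_mul (by positivity), ← ENNReal.ofReal_mul (by positivity), hX,
      mul_div_cancel₀ _ hα.ne']

/-- With the stopping time `𝒥 = stopST p λ₁ λ₂ V` as in the decay lemma
(`λ₁` depending only on `n, d, p`, `λ₂ = C_λ ‖W‖_{A_p}^{p'/p}`), and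
`T_j f = ∑_{I ∈ ℱ^j} ∑_{ε ∈ 𝒮} W^{1/p} V_I^{-1} f_I^ε h_I^ε`, there are constants
`C > 0` and `C' > 1` depending only on `p, n, d` (independent of `W` and `I₀`) such that
for every `f` with finite Haar expansion and all `k > j ≥ 1`,
`∫_{∪ 𝒥^{k-1}} |T_j f|^p ≤ C ‖W‖_{A_p} 2^{-(k-j-1)/(p C' ‖W‖_{A_p} + 1)} ‖Δ_j f‖_{L^p}^p`. -/
theorem statement11 (d n : ℕ) (hd : 0 < d) (hn : 0 < n) (p c₁ c₂ : ℝ)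
    (hp : 1 < p) (hc₁ : 0 < c₁) (hc₂ : 0 < c₂) :
    ∃ l₁ Cl C' : ℝ, ∃ C : ℝ≥0∞, 1 < l₁ ∧ 0 < Cl ∧ 1 < C' ∧ 0 < C ∧ C < ⊤ ∧
      ∀ (W1p : (Fin d → ℝ) → Matrix (Fin n) (Fin n) ℂ)
        (V : DCube d → Matrix (Fin n) (Fin n) ℂ)
        (I₀ : DCube d)
        (f : (Fin d → ℝ) → EuclideanSpace ℂ (Fin n)) (j k : ℕ),
        MatMeasurable W1p →
        (∀ᵐ x ∂(volume : Measure (Fin d → ℝ)), (W1p x).PosDef) →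
        apNorm p W1p < ⊤ →
        IsReducing p c₁ c₂ W1p V →
        FiniteHaar f →
        1 ≤ j → j < k →
        ∫⁻ x in
            ⋃ J ∈ JIter (stopST p l₁ (Cl * (apNorm p W1p).toReal ^ (1 / (p - 1))) V)
              (k - 1) I₀, DCube.set J,
            ENNReal.ofReal
              ‖mApp (W1p x)
                (projInv V
                  (Fj (stopST p l₁ (Cl * (apNorm p W1p).toReal ^ (1 / (p - 1))) V) I₀ j)
                  f x)‖ ^ p ≤
          C * apNorm p W1p *
            ENNReal.ofReal
              ((2 : ℝ) ^ (-(((k : ℝ) - (j : ℝ) - 1) /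
                (p * C' * (apNorm p W1p).toReal + 1)))) *
            ∫⁻ x, ENNReal.ofReal
              ‖deltaHaar (stopST p l₁ (Cl * (apNorm p W1p).toReal ^ (1 / (p - 1))) V)
                I₀ j f x‖ ^ p := by
  have hp0 : 0 < p := by linarith
  have hp1 : 0 < p - 1 := by linarith
  obtain ⟨l₁, L, hl₁, hL, hl₁', hL'⟩ := exists_stopping_constants n hn hp hc₁ hc₂
  obtain ⟨B, hB0, hB⟩ := exists_transform_bound d n hp
  set α := ENNReal.ofReal c₁ ^ p with hα
  set D := ENNReal.ofReal c₂ ^ p * 2 ^ d * ENNReal.ofReal l₁ with hD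
  set E := ENNReal.ofReal B * ENNReal.ofReal (L ^ (p - 1)) with hE
  have hαα0 : α * α ≠ 0 := mul_ne_zero (ofReal_rpow_ne_zero hc₁) (ofReal_rpow_ne_zero hc₁)
  have hααt : α * α ≠ ⊤ :=
    ENNReal.mul_ne_top (ofReal_rpow_ne_top hp0.le) (ofReal_rpow_ne_top hp0.le)
  have hD0 : D ≠ 0 := mul_ne_zero (mul_ne_zero (ofReal_rpow_ne_zero hc₂) (by simp))
    (ENNReal.ofReal_pos.2 (by linarith)).ne'
  have hDt : D ≠ ⊤ := ENNReal.mul_ne_top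
    (ENNReal.mul_ne_top (ofReal_rpow_ne_top hp0.le) (by finiteness)) ENNReal.ofReal_ne_top
  have hE0 : E ≠ 0 := mul_ne_zero (ENNReal.ofReal_pos.2 hB0).ne'
    (ENNReal.ofReal_pos.2 (by positivity)).ne'
  have hEt : E ≠ ⊤ := ENNReal.mul_ne_top ENNReal.ofReal_ne_top ENNReal.ofReal_ne_top
  refine ⟨l₁, L, 2 ^ p, (α * α)⁻¹ * (D * E), hl₁, hL,
    Real.one_lt_rpow (by norm_num) hp0, pos_iff_ne_zero.2 (mul_ne_zero
      (ENNReal.inv_ne_zero.2 hααt) (mul_ne_zero hD0 hE0)),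
    (ENNReal.mul_ne_top (ENNReal.inv_ne_top.2 hαα0) (ENNReal.mul_ne_top hDt hEt)).lt_top, ?_⟩
  intro W1p V I₀ f j k hW hpos hA hV hf hj hjk
  have hA1 := hV.one_le_apNorm hp hc₁ hn hW hpos I₀
  set A := apNorm p W1p with hAdef
  set a := A.toReal with ha
  have ha1 : 1 ≤ a := by simpa using ENNReal.toReal_mono hA.ne hA1
  set l₂ := L * a ^ (1 / (p - 1)) with hl₂
  have hl₂0 : 0 ≤ l₂ := by positivity
  have hl₂' : ENNReal.ofReal (l₂ ^ (p - 1)) = ENNReal.ofReal (L ^ (p - 1)) * A := by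
    rw [hl₂, Real.mul_rpow hL.le (by positivity), one_div, Real.rpow_inv_rpow (by positivity)
      hp1.ne', ENNReal.ofReal_mul (by positivity), ha, ENNReal.ofReal_toReal hA.ne]
  have hvol : ∀ I, 2 * volume (⋃ J ∈ stopST p l₁ l₂ V I, J.set) ≤ volume I.set :=
    hV.two_mul_volume_stopST_le hp (by linarith) hL hc₁ hc₂ hn hl₁' hL' hW hpos hA
  set t := 1 - 1 / (2 ^ p * a) with ht
  have hθ : ∀ v I, wMass p W1p v (⋃ J ∈ stopST p l₁ l₂ V I, J.set) ≤
      ENNReal.ofReal t * wMass p W1p v I.set := fun v I =>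
    wMass_le_of_two_mul_volume_le hp hW hpos hA1 hA I v (measurableSet_biUnion_cubes _)
      (Set.iUnion₂_subset (isStopping_stopST I).1) (hvol I)
      (hV.wMass_ne_top hp0 hc₁ I v subset_rfl)
  obtain ⟨m, rfl⟩ : ∃ m, k = j + 1 + m := Nat.exists_eq_add_of_lt hjk |>.imp fun m hm => by omega
  have ht0 : 0 ≤ t := by
    have hb : 1 ≤ (2 : ℝ) ^ p * a := one_le_mul_of_one_le_of_one_le
      (Real.one_le_rpow (by norm_num) hp0.le) ha1
    exact sub_nonneg.2 ((div_le_one (by linarith)).2 hb)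
  have htm : ENNReal.ofReal t ^ m ≤ ENNReal.ofReal
      ((2 : ℝ) ^ (-((((j + 1 + m : ℕ) : ℝ) - j - 1) / (p * 2 ^ p * a + 1)))) := by
    rw [← ENNReal.ofReal_pow ht0]
    refine ENNReal.ofReal_le_ofReal ((one_sub_pow_le_two_rpow hp ha1 m).trans_eq ?_)
    push_cast
    ring_nf
  have hmain := hV.lintegral_projInv_le hp hd (by linarith) hl₂0 hB hvol hθ I₀ j m hf
  rw [show j - 1 + (1 + m) = j + 1 + m - 1 by omega, mul_comm,
    ← ENNReal.le_div_iff_mul_le (Or.inl hαα0) (Or.inl hααt), hl₂'] at hmain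
  refine hmain.trans ?_
  rw [div_eq_mul_inv]
  calc _ = (α * α)⁻¹ * (D * E) * A * ENNReal.ofReal t ^ m *
        ∫⁻ x, ENNReal.ofReal ‖deltaHaar (stopST p l₁ l₂ V) I₀ j f x‖ ^ p := by
        rw [hE]
        ring
    _ ≤ _ := mul_le_mul' (mul_le_mul' le_rfl htm) le_rfl

end
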